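/- Let T be a finite tree on at least 2 vertices and let m = |{ i ∈ {1,…,|T|} : d_T(i) = Δ(T) }| be the number of vertices of T of maximum degree. Then P(D_max(T) > t) ∼ m · c(|T|, Δ(T)) · t^{1−2|T|+2Δ(T)} · exp(−t²/4) as t → ∞, where c(a,b) = Γ(2a−2) / (2^{b−1} Γ(a−1/2) Γ(b)) and f(t) ∼ g(t) means f(t)/g(t) → 1. -/

import Mathlib

open MeasureTheory Filter Real
open scoped ENNReal

noncomputable section

/-- The degree of vertex `v` in a graph on `ℕ`. -/
def degN (G : SimpleGraph ℕ) (v : ℕ) : ℕ := (G.neighborSet v).ncard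

/-- `G` is a tree on the vertex set `{0, …, k-1}` (all other vertices isolated). -/
def IsTreeOn (k : ℕ) (G : SimpleGraph ℕ) : Prop :=
  (∀ v w : ℕ, G.Adj v w → v < k ∧ w < k) ∧ (G.induce {v : ℕ | v < k}).IsTree

instance : MeasurableSpace (SimpleGraph ℕ) := ⊤

/-- Add the edge `uv` to `G`. -/
def addEdge (G : SimpleGraph ℕ) (u v : ℕ) : SimpleGraph ℕ :=
  G ⊔ SimpleGraph.fromEdgeSet {s(u, v)}

/-- One step of preferential attachment: the current graph has `n` vertices `0, …, n-1`;
the new vertex `n` attaches to an existing vertex `v` with probability `deg v / (2(n-1))`. -/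
def paStep (n : ℕ) (G : SimpleGraph ℕ) : Measure (SimpleGraph ℕ) :=
  Measure.sum fun v : ℕ =>
    ((degN G v : ℝ≥0∞) / ((2 * (n - 1) : ℕ) : ℝ≥0∞)) • Measure.dirac (addEdge G n v)

def PAlawAux (k : ℕ) (T : SimpleGraph ℕ) : ℕ → Measure (SimpleGraph ℕ)
  | 0 => Measure.dirac T
  | m + 1 => (PAlawAux k T m).bind (paStep (k + m))

/-- The law of `PA(n, T)` for a seed tree `T` on `k` vertices, as a measure on labelled
graphs on `ℕ` (vertices are labelled `0, 1, 2, …` in order of arrival). -/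
def PAlaw (k : ℕ) (T : SimpleGraph ℕ) (n : ℕ) : Measure (SimpleGraph ℕ) :=
  PAlawAux k T (n - k)

/-- Graphs on `ℕ` up to isomorphism. -/
def graphSetoid : Setoid (SimpleGraph ℕ) where
  r G H := Nonempty (G ≃g H)
  iseqv := ⟨fun G => ⟨RelIso.refl G.Adj⟩, fun ⟨e⟩ => ⟨e.symm⟩, fun ⟨e⟩ ⟨f⟩ => ⟨e.trans f⟩⟩

/-- Isomorphism types of graphs on `ℕ`. -/
def GraphType : Type := Quotient graphSetoid

instance : MeasurableSpace GraphType := ⊤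

/-- The law of the isomorphism type of `PA(n, T)`. -/
def PAtype (k : ℕ) (T : SimpleGraph ℕ) (n : ℕ) : Measure GraphType :=
  (PAlaw k T n).map (Quotient.mk graphSetoid)

/-- Total variation distance between two measures. -/
def tvDist {α : Type*} [MeasurableSpace α] (μ ν : Measure α) : ℝ :=
  ⨆ A : Set α, |(μ A).toReal - (ν A).toReal|

/-- `δ(S, T) = lim_n TV(PA(n,S), PA(n,T))`, the total variation distance being taken
between the laws of the isomorphism types.  The limit exists since the sequence is
non-increasing; we express it as a `limsup`, which agrees with the limit. -/
def deltaPA (kS : ℕ) (S : SimpleGraph ℕ) (kT : ℕ) (T : SimpleGraph ℕ) : ℝ :=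
  Filter.limsup (fun n : ℕ => tvDist (PAtype kS S n) (PAtype kT T n)) Filter.atTop


/-- The constant `c(a,b) = Γ(2a-2) / (2^(b-1) Γ(a-1/2) Γ(b))`. -/
def cconst (a b : ℝ) : ℝ :=
  Real.Gamma (2 * a - 2) / ((2 : ℝ) ^ (b - 1) * Real.Gamma (a - 1 / 2) * Real.Gamma b)

/-- The maximum degree of a graph on `ℕ`. -/
def maxDeg (G : SimpleGraph ℕ) : ℕ := ⨆ v : ℕ, degN G v

/-- `G` has the size profile of a preferential attachment tree on `{0, …, n-1}`: all edges lie
inside this set and the degrees sum to `2(n-1)`. -/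
def IsPAGraph (n : ℕ) (G : SimpleGraph ℕ) : Prop :=
  (∀ v w : ℕ, G.Adj v w → v < n ∧ w < n) ∧ ∑ v ∈ Finset.range n, degN G v = 2 * (n - 1)

/-- The total degree of the vertices in `A`. -/
def degSum (A : Finset ℕ) (G : SimpleGraph ℕ) : ℕ := ∑ v ∈ A, degN G v

lemma neighborSet_subset_Iio {n : ℕ} {G : SimpleGraph ℕ}
    (h : ∀ v w : ℕ, G.Adj v w → v < n ∧ w < n) (v : ℕ) : G.neighborSet v ⊆ Set.Iio n :=
  fun _ hw => (h _ _ hw).2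

lemma degN_eq_zero {n : ℕ} {G : SimpleGraph ℕ}
    (h : ∀ v w : ℕ, G.Adj v w → v < n ∧ w < n) {v : ℕ} (hv : n ≤ v) : degN G v = 0 := by
  have : G.neighborSet v = ∅ := by
    ext w
    simp only [SimpleGraph.mem_neighborSet, Set.mem_empty_iff_false, iff_false]
    exact fun hw => absurd (h _ _ hw).1 (not_lt.2 hv)
  simp [degN, this]

lemma degN_le {n : ℕ} {G : SimpleGraph ℕ}
    (h : ∀ v w : ℕ, G.Adj v w → v < n ∧ w < n) (v : ℕ) : degN G v ≤ n := by
  have := Set.ncard_le_ncard (neighborSet_subset_Iio h v) (Set.finite_Iio n)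
  simpa [degN, Set.ncard_eq_toFinset_card'] using this

lemma bddAbove_degN {n : ℕ} {G : SimpleGraph ℕ}
    (h : ∀ v w : ℕ, G.Adj v w → v < n ∧ w < n) : BddAbove (Set.range (degN G)) :=
  ⟨n, by rintro _ ⟨v, rfl⟩; exact degN_le h v⟩

lemma degN_le_maxDeg {n : ℕ} {G : SimpleGraph ℕ}
    (h : ∀ v w : ℕ, G.Adj v w → v < n ∧ w < n) (v : ℕ) : degN G v ≤ maxDeg G :=
  le_ciSup (bddAbove_degN h) v

lemma exists_degN_eq_maxDeg {n : ℕ} {G : SimpleGraph ℕ}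
    (h : ∀ v w : ℕ, G.Adj v w → v < n ∧ w < n) : ∃ v, degN G v = maxDeg G :=
  Nat.sSup_mem (Set.range_nonempty _) (bddAbove_degN h)

lemma addEdge_adj {G : SimpleGraph ℕ} {n v a b : ℕ} (hv : v ≠ n) :
    (addEdge G n v).Adj a b ↔ G.Adj a b ∨ (a = n ∧ b = v) ∨ (a = v ∧ b = n) := by
  simp only [addEdge, SimpleGraph.sup_adj, SimpleGraph.fromEdgeSet_adj, Set.mem_singleton_iff,
    Sym2.eq_iff]
  constructor
  · rintro (h | ⟨h | h, -⟩) <;> simp [h]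
  · rintro (h | ⟨rfl, rfl⟩ | ⟨rfl, rfl⟩)
    · exact Or.inl h
    · exact Or.inr ⟨by simp, hv.symm⟩
    · exact Or.inr ⟨by simp, hv⟩

lemma degN_addEdge {n : ℕ} {G : SimpleGraph ℕ}
    (h : ∀ v w : ℕ, G.Adj v w → v < n ∧ w < n) {v : ℕ} (hv : v < n) (w : ℕ) :
    degN (addEdge G n v) w = degN G w + if w = v ∨ w = n then 1 else 0 := by
  have hfin : (G.neighborSet w).Finite := (Set.finite_Iio n).subset (neighborSet_subset_Iio h w)
  unfold degN
  by_cases h1 : w = v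
  · subst h1
    have : (addEdge G n w).neighborSet w = insert n (G.neighborSet w) := by
      ext b
      simp only [SimpleGraph.mem_neighborSet, Set.mem_insert_iff, addEdge_adj hv.ne]
      have := hv.ne
      tauto
    rw [this, Set.ncard_insert_of_notMem _ hfin]
    · simp
    · exact fun hn => absurd (h _ _ hn).2 (lt_irrefl _)
  · by_cases h2 : w = n
    · subst h2
      have : (addEdge G w v).neighborSet w = insert v (G.neighborSet w) := by
        ext b
        simp only [SimpleGraph.mem_neighborSet, Set.mem_insert_iff, addEdge_adj hv.ne]
        tauto
      rw [this, Set.ncard_insert_of_notMem _ hfin]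
      · simp
      · exact fun hn => absurd (h _ _ hn).1 (lt_irrefl _)
    · have : (addEdge G n v).neighborSet w = G.neighborSet w := by
        ext b
        simp only [SimpleGraph.mem_neighborSet, addEdge_adj hv.ne]
        tauto
      simp [this, h1, h2]

lemma IsPAGraph.addEdge {n : ℕ} {G : SimpleGraph ℕ} (hG : IsPAGraph n G) {v : ℕ} (hv : v < n) :
    IsPAGraph (n + 1) (addEdge G n v) := by
  refine ⟨fun a b hab => ?_, ?_⟩
  · rw [addEdge_adj hv.ne] at hab
    rcases hab with hab | hab | hab
    · have := hG.1 _ _ hab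
      omega
    · omega
    · omega
  · simp_rw [degN_addEdge hG.1 hv]
    rw [Finset.sum_range_succ, Finset.sum_add_distrib, hG.2, degN_eq_zero hG.1 le_rfl]
    have : ∑ x ∈ Finset.range n, (if x = v ∨ x = n then 1 else 0) = 1 := by
      rw [Finset.sum_eq_single v]
      · simp
      · intro b hb hbv
        have := Finset.mem_range.1 hb
        simp [hbv, this.ne]
      · intro hv'
        simp [hv] at hv'
    rw [this]
    simp
    omega

lemma degSum_addEdge {n : ℕ} {G : SimpleGraph ℕ} (hG : IsPAGraph n G) {A : Finset ℕ}
    (hA : A ⊆ Finset.range n) {v : ℕ} (hv : v < n) :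
    degSum A (addEdge G n v) = degSum A G + if v ∈ A then 1 else 0 := by
  unfold degSum
  simp_rw [degN_addEdge hG.1 hv]
  rw [Finset.sum_add_distrib]
  congr 1
  have : ∀ x ∈ A, (if x = v ∨ x = n then 1 else 0) = if x = v then 1 else 0 := by
    intro x hx
    have := Finset.mem_range.1 (hA hx)
    simp [this.ne]
  rw [Finset.sum_congr rfl this]
  simp

lemma lintegral_paStep {n : ℕ} {G : SimpleGraph ℕ} (hG : IsPAGraph n G)
    (f : SimpleGraph ℕ → ℝ≥0∞) :
    ∫⁻ H, f H ∂paStep n G = ∑ v ∈ Finset.range n,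
      ((degN G v : ℝ≥0∞) / ((2 * (n - 1) : ℕ) : ℝ≥0∞)) * f (addEdge G n v) := by
  unfold paStep
  rw [lintegral_sum_measure, tsum_eq_sum (s := Finset.range n)]
  · refine Finset.sum_congr rfl fun v _ => ?_
    rw [lintegral_smul_measure, lintegral_dirac' _ measurable_from_top, smul_eq_mul]
  · intro v hv
    rw [degN_eq_zero hG.1 (by simpa using hv)]
    simp

lemma mul_ascFactorial_succ_base (D r : ℕ) :
    D * (D + 1).ascFactorial r = (D + r) * D.ascFactorial r := by
  induction r with
  | zero => simp
  | succ r ih =>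
    rw [Nat.ascFactorial_succ, Nat.ascFactorial_succ, mul_left_comm, ih]
    ring

lemma lintegral_paStep_ascFactorial {n : ℕ} {G : SimpleGraph ℕ}
    (hG : IsPAGraph n G) {A : Finset ℕ} (hA : A ⊆ Finset.range n) (r : ℕ) :
    ∫⁻ H, ((degSum A H).ascFactorial r : ℝ≥0∞) ∂paStep n G =
      ((2 * (n - 1) + r : ℕ) : ℝ≥0∞) / ((2 * (n - 1) : ℕ) : ℝ≥0∞) *
        ((degSum A G).ascFactorial r : ℝ≥0∞) := by
  rw [lintegral_paStep hG]
  set D := degSum A G with hD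
  have key : ∑ v ∈ Finset.range n, degN G v * (degSum A (addEdge G n v)).ascFactorial r =
      (2 * (n - 1) + r) * D.ascFactorial r := by
    have h1 : ∀ v ∈ Finset.range n,
        degN G v * (degSum A (addEdge G n v)).ascFactorial r +
          (if v ∈ A then degN G v * D.ascFactorial r else 0) =
        degN G v * D.ascFactorial r +
          (if v ∈ A then degN G v * (D + 1).ascFactorial r else 0) := by
      intro v hv
      rw [degSum_addEdge hG hA (Finset.mem_range.1 hv), ← hD]
      by_cases hvA : v ∈ A <;> simp [hvA, add_comm]
    have h2 := Finset.sum_congr rfl h1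
    rw [Finset.sum_add_distrib, Finset.sum_add_distrib, Finset.sum_ite_mem, Finset.sum_ite_mem,
      Finset.inter_eq_right.2 hA, ← Finset.sum_mul, ← Finset.sum_mul, ← Finset.sum_mul, hG.2,
      show ∑ i ∈ A, degN G i = D from rfl, mul_ascFactorial_succ_base] at h2
    linarith
  have hc : ∀ v ∈ Finset.range n, ((degN G v : ℝ≥0∞) / ((2 * (n - 1) : ℕ) : ℝ≥0∞)) *
      ((degSum A (addEdge G n v)).ascFactorial r : ℝ≥0∞) =
      ((2 * (n - 1) : ℕ) : ℝ≥0∞)⁻¹ *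
        ((degN G v * (degSum A (addEdge G n v)).ascFactorial r : ℕ) : ℝ≥0∞) := by
    intro v _
    rw [Nat.cast_mul (degN G v), ENNReal.div_eq_inv_mul, mul_assoc]
  rw [Finset.sum_congr rfl hc, ← Finset.mul_sum, ← Nat.cast_sum, key,
    Nat.cast_mul (2 * (n - 1) + r), ENNReal.div_eq_inv_mul, mul_assoc]

lemma isProbabilityMeasure_paStep {n : ℕ} (hn : 2 ≤ n) {G : SimpleGraph ℕ}
    (hG : IsPAGraph n G) : IsProbabilityMeasure (paStep n G) := by
  constructor
  have := lintegral_paStep_ascFactorial hG (A := ∅) (by simp) 0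
  have h0 : ((2 * (n - 1) : ℕ) : ℝ≥0∞) ≠ 0 := by
    rw [Nat.cast_ne_zero]; omega
  simpa [-Nat.cast_mul, ENNReal.div_self h0 (ENNReal.natCast_ne_top _)] using this

lemma ae_paStep {n : ℕ} {G : SimpleGraph ℕ} (hG : IsPAGraph n G) {p : SimpleGraph ℕ → Prop}
    (h : ∀ v < n, p (addEdge G n v)) : ∀ᵐ H ∂paStep n G, p H := by
  rw [ae_iff, ← lintegral_indicator_one (MeasurableSpace.measurableSet_top), lintegral_paStep hG]
  refine Finset.sum_eq_zero fun v hv => ?_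
  simp [h v (Finset.mem_range.1 hv)]

lemma degree_induce_eq_degN {k : ℕ} {T : SimpleGraph ℕ}
    (h : ∀ v w : ℕ, T.Adj v w → v < k ∧ w < k) (v : {v : ℕ | v < k})
    [Fintype ((T.induce {v : ℕ | v < k}).neighborSet v)] :
    (T.induce {v : ℕ | v < k}).degree v = degN T v := by
  have himg : T.neighborSet v = Subtype.val '' ((T.induce {v : ℕ | v < k}).neighborSet v) := by
    ext w
    simp only [SimpleGraph.mem_neighborSet, Set.mem_image, SimpleGraph.comap_adj,
      Function.Embedding.subtype_apply, Subtype.exists]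
    constructor
    · intro hw
      exact ⟨w, (h _ _ hw).2, hw, rfl⟩
    · rintro ⟨a, _, ha, rfl⟩
      exact ha
  rw [degN, himg, Set.ncard_image_of_injective _ Subtype.val_injective,
    ← SimpleGraph.card_neighborSet_eq_degree, Set.ncard_eq_toFinset_card', Set.toFinset_card]

lemma IsTreeOn.isPAGraph {k : ℕ} {T : SimpleGraph ℕ} (hT : IsTreeOn k T) :
    IsPAGraph k T := by
  classical
  refine ⟨hT.1, ?_⟩
  have : Fintype {v : ℕ | v < k} := Set.fintypeLTNat k
  have h1 := hT.2.card_edgeFinset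
  have h2 := (T.induce {v : ℕ | v < k}).sum_degrees_eq_twice_card_edges
  have hcard : Fintype.card {v : ℕ | v < k} = k :=
    (Fintype.card_of_subtype (Finset.range k) (by simp)).trans (Finset.card_range k)
  simp_rw [degree_induce_eq_degN hT.1] at h2
  rw [hcard] at h1
  have h3 : ∑ v ∈ Finset.range k, degN T v = ∑ x : {v : ℕ | v < k}, degN T x :=
    (Finset.sum_subtype (Finset.range k) (p := fun v => v ∈ {v : ℕ | v < k}) (by simp) (degN T))
  rw [h3, h2]
  omega

lemma IsTreeOn.degN_pos {k : ℕ} {T : SimpleGraph ℕ} (hk : 2 ≤ k) (hT : IsTreeOn k T)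
    {v : ℕ} (hv : v < k) : 0 < degN T v := by
  classical
  have : Fintype {v : ℕ | v < k} := Set.fintypeLTNat k
  have : Nontrivial {v : ℕ | v < k} :=
    ⟨⟨⟨0, by simp; omega⟩, ⟨1, by simp; omega⟩, by simp⟩⟩
  have := hT.2.connected.preconnected.degree_pos_of_nontrivial ⟨v, hv⟩
  rwa [degree_induce_eq_degN hT.1] at this

lemma IsTreeOn.degN_lt {k : ℕ} {T : SimpleGraph ℕ} (hT : IsTreeOn k T)
    {v : ℕ} (hv : v < k) : degN T v < k := by
  have h : T.neighborSet v ⊆ (Finset.range k).erase v := by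
    intro w hw
    have := hT.1 _ _ hw
    have := T.ne_of_adj hw
    simp
    omega
  have := Set.ncard_le_ncard h (Finset.finite_toSet _)
  rw [Set.ncard_coe_finset, Finset.card_erase_of_mem (by simpa using hv), Finset.card_range] at this
  unfold degN
  omega

lemma ae_bind_of_ae {α β : Type*} [MeasurableSpace α] [MeasurableSpace β] {m : Measure α}
    {f : α → Measure β} {p : β → Prop} (hp : MeasurableSet {b | ¬ p b})
    (h : ∀ᵐ a ∂m, ∀ᵐ b ∂f a, p b) : ∀ᵐ b ∂m.bind f, p b := by
  rw [ae_iff]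
  refine le_antisymm ((Measure.bind_apply_le f hp).trans ?_) zero_le
  have h' : ∀ᵐ a ∂m, f a {b | ¬ p b} = 0 := h
  rw [lintegral_congr_ae h']
  simp

lemma PAlaw_self (k : ℕ) (T : SimpleGraph ℕ) : PAlaw k T k = Measure.dirac T := by
  simp [PAlaw, PAlawAux]

lemma PAlaw_succ {k n : ℕ} (T : SimpleGraph ℕ) (hn : k ≤ n) :
    PAlaw k T (n + 1) = (PAlaw k T n).bind (paStep n) := by
  unfold PAlaw
  rw [Nat.sub_add_comm hn, PAlawAux, Nat.add_sub_cancel' hn]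

lemma ae_isPAGraph {k n : ℕ} {T : SimpleGraph ℕ} (hT : IsTreeOn k T) (hn : k ≤ n) :
    ∀ᵐ G ∂PAlaw k T n, IsPAGraph n G := by
  induction n, hn using Nat.le_induction with
  | base =>
    rw [PAlaw_self, ae_dirac_iff MeasurableSpace.measurableSet_top]
    exact hT.isPAGraph
  | succ n hn ih =>
    rw [PAlaw_succ T hn]
    refine ae_bind_of_ae MeasurableSpace.measurableSet_top ?_
    filter_upwards [ih] with G hG
    exact ae_paStep hG fun v hv => hG.addEdge hv

lemma ae_degN_eq_one {k n : ℕ} {T : SimpleGraph ℕ} (hT : IsTreeOn k T)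
    (hn : k ≤ n) : ∀ᵐ G ∂PAlaw k T (n + 1), degN G n = 1 := by
  rw [PAlaw_succ T hn]
  refine ae_bind_of_ae MeasurableSpace.measurableSet_top ?_
  filter_upwards [ae_isPAGraph hT hn] with G hG
  refine ae_paStep hG fun v hv => ?_
  rw [degN_addEdge hG.1 hv, degN_eq_zero hG.1 le_rfl]
  simp

lemma isProbabilityMeasure_PAlaw {k n : ℕ} {T : SimpleGraph ℕ} (hk : 2 ≤ k) (hT : IsTreeOn k T)
    (hn : k ≤ n) : IsProbabilityMeasure (PAlaw k T n) := by
  induction n, hn using Nat.le_induction with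
  | base =>
    rw [PAlaw_self]
    infer_instance
  | succ n hn ih =>
    constructor
    rw [PAlaw_succ T hn, Measure.bind_apply MeasurableSet.univ measurable_from_top.aemeasurable]
    have : ∀ᵐ G ∂PAlaw k T n, paStep n G Set.univ = 1 := by
      filter_upwards [ae_isPAGraph hT hn] with G hG
      exact (isProbabilityMeasure_paStep (hk.trans hn) hG).measure_univ
    rw [lintegral_congr_ae this]
    simp

lemma lintegral_PAlaw_succ_ascFactorial {k n : ℕ} {T : SimpleGraph ℕ}
    (hT : IsTreeOn k T) (hn : k ≤ n) {A : Finset ℕ} (hA : A ⊆ Finset.range n) (r : ℕ) :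
    ∫⁻ H, ((degSum A H).ascFactorial r : ℝ≥0∞) ∂PAlaw k T (n + 1) =
      ((2 * (n - 1) + r : ℕ) : ℝ≥0∞) / ((2 * (n - 1) : ℕ) : ℝ≥0∞) *
        ∫⁻ G, ((degSum A G).ascFactorial r : ℝ≥0∞) ∂PAlaw k T n := by
  rw [PAlaw_succ T hn, Measure.lintegral_bind measurable_from_top.aemeasurable
    measurable_from_top.aemeasurable, ← lintegral_const_mul _ measurable_from_top]
  refine lintegral_congr_ae ?_
  filter_upwards [ae_isPAGraph hT hn] with G hG
  exact lintegral_paStep_ascFactorial hG hA r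

lemma tendsto_Gamma_ratio {s : ℝ} (hs : 0 ≤ s) :
    Tendsto (fun n : ℕ => Gamma ((n : ℝ) - 1 + s) / (Gamma ((n : ℝ) - 1) * (n : ℝ) ^ s))
      atTop (nhds 1) := by
  have hprod : ∀ (x : ℝ), 0 < x → ∀ n : ℕ,
      Gamma (x + n) = (∏ j ∈ Finset.range n, (x + j)) * Gamma x := by
    intro x hx n
    induction n with
    | zero => simp
    | succ n ih =>
      rw [Finset.prod_range_succ, Nat.cast_succ, ← add_assoc, Gamma_add_one (by positivity), ih]
      ring
  have hG : 0 < Gamma (s + 1) := Gamma_pos_of_pos (by positivity)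
  have h2 : Tendsto (fun n : ℕ => Gamma (s + 1) / GammaSeq (s + 1) n) atTop (nhds 1) := by
    have := (tendsto_const_nhds (x := Gamma (s + 1))).div (GammaSeq_tendsto_Gamma (s + 1)) hG.ne'
    rwa [div_self hG.ne'] at this
  have h3 : Tendsto (fun n : ℕ => ((n : ℝ) / ((n : ℝ) + 2)) ^ s *
      ((n : ℝ) / ((n : ℝ) + (s + 1)))) atTop (nhds 1) := by
    have a1 : Tendsto (fun n : ℕ => (n : ℝ) / ((n : ℝ) + 2)) atTop (nhds 1) :=
      tendsto_natCast_div_add_atTop (2 : ℝ)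
    have a2 : Tendsto (fun n : ℕ => (n : ℝ) / ((n : ℝ) + (s + 1))) atTop (nhds 1) :=
      tendsto_natCast_div_add_atTop (s + 1 : ℝ)
    have := (a1.rpow_const (p := s) (Or.inl one_ne_zero)).mul a2
    simpa using this
  have h4 := h2.mul h3
  rw [mul_one] at h4
  rw [← tendsto_add_atTop_iff_nat 2]
  refine h4.congr' ?_
  filter_upwards [eventually_gt_atTop 0] with n hn
  have hn' : (0 : ℝ) < n := Nat.cast_pos.2 hn
  rw [show ((n + 2 : ℕ) : ℝ) - 1 + s = (s + 1) + n by push_cast; ring,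
    hprod (s + 1) (by positivity),
    show ((n + 2 : ℕ) : ℝ) - 1 = n + 1 by push_cast; ring, Gamma_nat_eq_factorial, GammaSeq,
    Finset.prod_range_succ, div_rpow hn'.le (by positivity), rpow_add_one hn'.ne']
  push_cast
  have hP : 0 < ∏ j ∈ Finset.range n, (s + 1 + (j : ℝ)) :=
    Finset.prod_pos fun j _ => by positivity
  have hf : (0 : ℝ) < n.factorial := by positivity
  have hr : (0 : ℝ) < (n : ℝ) ^ s := by positivity
  have hr2 : (0 : ℝ) < ((n : ℝ) + 2) ^ s := by positivity
  have hs1 : (0 : ℝ) < s + 1 + n := by positivity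
  have hs2 : (0 : ℝ) < n + (s + 1) := by positivity
  field_simp
  ring

/-- The limit of the `r`-th moment of a rescaled total degree that starts from `d` at time `n₀`. -/
def limMoment (n₀ d r : ℕ) : ℝ :=
  d.ascFactorial r * Gamma ((n₀ : ℝ) - 1) / Gamma ((n₀ : ℝ) - 1 + r / 2)

section Moments

variable {k n₀ d : ℕ} {T : SimpleGraph ℕ} {A : Finset ℕ}

lemma ae_degSum_le {n : ℕ} (hT : IsTreeOn k T) (hn : k ≤ n) (A : Finset ℕ) :
    ∀ᵐ G ∂PAlaw k T n, degSum A G ≤ A.card * n := by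
  filter_upwards [ae_isPAGraph hT hn] with G hG
  exact Finset.sum_le_card_nsmul A _ _ fun v _ => degN_le hG.1 v

lemma integrable_comp_degSum {n : ℕ} (hk : 2 ≤ k) (hT : IsTreeOn k T) (hn : k ≤ n)
    (A : Finset ℕ) (f : ℕ → ℝ) : Integrable (fun G => f (degSum A G)) (PAlaw k T n) := by
  have := isProbabilityMeasure_PAlaw hk hT hn
  refine Integrable.of_bound (C := ∑ j ∈ Finset.range (A.card * n + 1), ‖f j‖)
    measurable_from_top.aestronglyMeasurable ?_
  filter_upwards [ae_degSum_le hT hn A] with G hG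
  exact Finset.single_le_sum (f := fun j => ‖f j‖) (fun _ _ => norm_nonneg _)
    (Finset.mem_range.2 (Nat.lt_succ_of_le hG))

lemma lintegral_ascFactorial_eq_ofReal {n : ℕ} (hk : 2 ≤ k) (hT : IsTreeOn k T) (hn : k ≤ n)
    (A : Finset ℕ) (r : ℕ) :
    ∫⁻ G, ((degSum A G).ascFactorial r : ℝ≥0∞) ∂PAlaw k T n =
      ENNReal.ofReal (∫ G, ((degSum A G).ascFactorial r : ℝ) ∂PAlaw k T n) := by
  rw [ofReal_integral_eq_lintegral_ofReal
    (integrable_comp_degSum hk hT hn A fun j => (j.ascFactorial r : ℝ))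
    (ae_of_all _ fun _ => by positivity)]
  simp

lemma integral_ascFactorial_succ {n : ℕ} (hk : 2 ≤ k) (hT : IsTreeOn k T) (hn : k ≤ n)
    (hA : A ⊆ Finset.range n) (r : ℕ) :
    ∫ G, ((degSum A G).ascFactorial r : ℝ) ∂PAlaw k T (n + 1) =
      ((n : ℝ) - 1 + r / 2) / ((n : ℝ) - 1) *
        ∫ G, ((degSum A G).ascFactorial r : ℝ) ∂PAlaw k T n := by
  have h := lintegral_PAlaw_succ_ascFactorial hT hn hA r
  rw [lintegral_ascFactorial_eq_ofReal hk hT hn, lintegral_ascFactorial_eq_ofReal hk hT (by omega)]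
    at h
  have h' := congrArg ENNReal.toReal h
  have e1 : ((n - 1 : ℕ) : ℝ) = (n : ℝ) - 1 := by
    rw [Nat.cast_sub (by omega)]; simp
  have hn1 : (0 : ℝ) < (n : ℝ) - 1 := by
    rw [← e1]; exact Nat.cast_pos.2 (by omega)
  rw [ENNReal.toReal_mul, ENNReal.toReal_div, ENNReal.toReal_natCast, ENNReal.toReal_natCast,
    ENNReal.toReal_ofReal (integral_nonneg fun _ => by positivity),
    ENNReal.toReal_ofReal (integral_nonneg fun _ => by positivity)] at h'
  rw [h']
  push_cast
  rw [e1]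
  field_simp

lemma integral_ascFactorial {n : ℕ} (hk : 2 ≤ k) (hT : IsTreeOn k T) (hn₀ : k ≤ n₀)
    (hA : A ⊆ Finset.range n₀) (hd : ∀ᵐ G ∂PAlaw k T n₀, degSum A G = d) (r : ℕ) (hn : n₀ ≤ n) :
    ∫ G, ((degSum A G).ascFactorial r : ℝ) ∂PAlaw k T n =
      limMoment n₀ d r * (Gamma ((n : ℝ) - 1 + r / 2) / Gamma ((n : ℝ) - 1)) := by
  have hpos : ∀ m : ℕ, n₀ ≤ m → (0 : ℝ) < (m : ℝ) - 1 := by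
    intro m hm
    have : (2 : ℝ) ≤ m := by exact_mod_cast (hk.trans (hn₀.trans hm))
    linarith
  induction n, hn using Nat.le_induction with
  | base =>
    have := isProbabilityMeasure_PAlaw hk hT hn₀
    have h1 : ∫ G, ((degSum A G).ascFactorial r : ℝ) ∂PAlaw k T n₀ = d.ascFactorial r := by
      rw [integral_congr_ae (g := fun _ => (d.ascFactorial r : ℝ))]
      · simp
      · filter_upwards [hd] with G hG
        rw [hG]
    have h2 := hpos n₀ le_rfl
    have h3 := Gamma_pos_of_pos h2
    have h4 : 0 < Gamma ((n₀ : ℝ) - 1 + r / 2) := Gamma_pos_of_pos (by positivity)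
    rw [h1, limMoment]
    field_simp
  | succ n hn ih =>
    have h2 := hpos n hn
    rw [integral_ascFactorial_succ hk hT (hn₀.trans hn)
      (hA.trans (Finset.range_subset_range.2 hn)), ih]
    push_cast
    rw [show (n : ℝ) + 1 - 1 + r / 2 = ((n : ℝ) - 1 + r / 2) + 1 by ring,
      show (n : ℝ) + 1 - 1 = ((n : ℝ) - 1) + 1 by ring, Gamma_add_one (by positivity),
      Gamma_add_one (by positivity)]
    have h3 := Gamma_pos_of_pos h2
    field_simp

lemma tendsto_integral_ascFactorial (hk : 2 ≤ k) (hT : IsTreeOn k T) (hn₀ : k ≤ n₀)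
    (hA : A ⊆ Finset.range n₀) (hd : ∀ᵐ G ∂PAlaw k T n₀, degSum A G = d) (r : ℕ) :
    Tendsto (fun n : ℕ => (∫ G, ((degSum A G).ascFactorial r : ℝ) ∂PAlaw k T n) / √n ^ r)
      atTop (nhds (limMoment n₀ d r)) := by
  have h := (tendsto_Gamma_ratio (s := r / 2) (by positivity)).const_mul (limMoment n₀ d r)
  rw [mul_one] at h
  refine h.congr' ?_
  filter_upwards [eventually_ge_atTop n₀] with n hn
  rw [integral_ascFactorial hk hT hn₀ hA hd r hn, sqrt_eq_rpow, ← rpow_natCast,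
    ← rpow_mul (by positivity), one_div_mul_eq_div]
  ring

lemma tendsto_integral_pow_mul_ascFactorial (hk : 2 ≤ k) (hT : IsTreeOn k T) (hn₀ : k ≤ n₀)
    (hA : A ⊆ Finset.range n₀) (hd : ∀ᵐ G ∂PAlaw k T n₀, degSum A G = d) (s r : ℕ) :
    Tendsto (fun n : ℕ =>
      (∫ G, ((degSum A G : ℝ) ^ s * (degSum A G).ascFactorial r) ∂PAlaw k T n) / √n ^ (r + s))
      atTop (nhds (limMoment n₀ d (r + s))) := by
  induction s generalizing r with
  | zero => simpa using tendsto_integral_ascFactorial hk hT hn₀ hA hd r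
  | succ s ih =>
    have h1 := ih (r + 1)
    have hinv : Tendsto (fun n : ℕ => (r : ℝ) * (√n)⁻¹) atTop (nhds 0) := by
      have := (tendsto_inv_atTop_zero.comp
        (tendsto_sqrt_atTop.comp tendsto_natCast_atTop_atTop)).const_mul (r : ℝ) (α := ℕ)
      simpa using this
    have h2 := h1.sub (hinv.mul (ih r))
    rw [zero_mul, sub_zero, show r + 1 + s = r + (s + 1) by ring] at h2
    refine h2.congr' ?_
    filter_upwards [eventually_ge_atTop n₀, eventually_gt_atTop 0] with n hn hn'
    have hsq : 0 < √(n : ℝ) := sqrt_pos.2 (Nat.cast_pos.2 hn')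
    have hInt := fun a b => integrable_comp_degSum hk hT (hn₀.trans hn) A
      (fun j => (j : ℝ) ^ a * j.ascFactorial b)
    have key : ∫ G, ((degSum A G : ℝ) ^ (s + 1) * (degSum A G).ascFactorial r) ∂PAlaw k T n =
        (∫ G, ((degSum A G : ℝ) ^ s * (degSum A G).ascFactorial (r + 1)) ∂PAlaw k T n) -
        r * ∫ G, ((degSum A G : ℝ) ^ s * (degSum A G).ascFactorial r) ∂PAlaw k T n := by
      rw [← integral_const_mul, ← integral_sub (hInt s (r + 1)) ((hInt s r).const_mul _)]
      refine integral_congr_ae (ae_of_all _ fun G => ?_)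
      simp only [Nat.ascFactorial_succ]
      push_cast
      ring
    rw [key]
    field_simp
    ring

/-- Convergence of the moments of the rescaled total degree. -/
lemma tendsto_integral_pow (hk : 2 ≤ k) (hT : IsTreeOn k T) (hn₀ : k ≤ n₀)
    (hA : A ⊆ Finset.range n₀) (hd : ∀ᵐ G ∂PAlaw k T n₀, degSum A G = d) (s : ℕ) :
    Tendsto (fun n : ℕ => ∫ G, ((degSum A G : ℝ) / √n) ^ s ∂PAlaw k T n)
      atTop (nhds (limMoment n₀ d s)) := by
  have h := tendsto_integral_pow_mul_ascFactorial hk hT hn₀ hA hd s 0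
  rw [zero_add] at h
  refine h.congr fun n => ?_
  simp_rw [div_pow, Nat.ascFactorial_zero, Nat.cast_one, mul_one]
  rw [integral_div]

/-- A fourth moment bound for the degree of a vertex that is not in the seed. -/
lemma measure_degN_ge_le {n i : ℕ} (hk : 2 ≤ k) (hT : IsTreeOn k T) (hi : k ≤ i) (hn : i < n)
    {t : ℝ} (ht : 0 < t) :
    (PAlaw k T n).real {G | t * √n ≤ degN G i} ≤ 24 / t ^ 4 * (1 / ((i : ℝ) * (i + 1))) := by
  have hi2 : (2 : ℝ) ≤ i := by exact_mod_cast hk.trans hi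
  have hn0 : (i : ℝ) + 1 ≤ n := by exact_mod_cast hn
  have hprob := isProbabilityMeasure_PAlaw hk hT (n := n) (by omega)
  have hmom := integral_ascFactorial (n₀ := i + 1) (n := n) (A := {i}) (d := 1) hk hT (by omega)
    (by simp) (by simpa [degSum] using ae_degN_eq_one hT hi) 4 hn
  have hval : limMoment (i + 1) 1 4 * (Gamma ((n : ℝ) - 1 + (4 : ℕ) / 2) / Gamma ((n : ℝ) - 1)) =
      24 * (((n : ℝ) - 1) * n) / (i * (i + 1)) := by
    have g1 : Gamma ((n : ℝ) - 1 + (4 : ℕ) / 2) = n * ((n - 1) * Gamma ((n : ℝ) - 1)) := by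
      rw [show (n : ℝ) - 1 + (4 : ℕ) / 2 = ((n : ℝ) - 1 + 1) + 1 by push_cast; ring,
        Gamma_add_one (by linarith), Gamma_add_one (by linarith)]
      ring
    have g2 : Gamma (((i + 1 : ℕ) : ℝ) - 1 + (4 : ℕ) / 2) = (i + 1) * (i * Gamma i) := by
      rw [show ((i + 1 : ℕ) : ℝ) - 1 + (4 : ℕ) / 2 = ((i : ℝ) + 1) + 1 by push_cast; ring,
        Gamma_add_one (by linarith), Gamma_add_one (by linarith)]
    have g3 : 0 < Gamma (i : ℝ) := Gamma_pos_of_pos (by linarith)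
    have g4 : 0 < Gamma ((n : ℝ) - 1) := Gamma_pos_of_pos (by linarith)
    rw [limMoment, g1, g2, show ((i + 1 : ℕ) : ℝ) - 1 = i by push_cast; ring,
      Nat.one_ascFactorial, show Nat.factorial 4 = 24 from rfl]
    push_cast
    have : (0 : ℝ) < i := by linarith
    field_simp
  rw [hval] at hmom
  have hmk := mul_meas_ge_le_integral_of_nonneg (μ := PAlaw k T n)
    (f := fun G => ((degSum {i} G).ascFactorial 4 : ℝ)) (ae_of_all _ fun _ => by positivity)
    (integrable_comp_degSum hk hT (by omega) {i} fun j => (j.ascFactorial 4 : ℝ)) ((t * √n) ^ 4)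
  rw [hmom] at hmk
  have hsub : (PAlaw k T n).real {G | t * √n ≤ degN G i} ≤
      (PAlaw k T n).real {G | (t * √n) ^ 4 ≤ ((degSum {i} G).ascFactorial 4 : ℝ)} := by
    refine measureReal_mono (fun G hG => ?_)
    simp only [Set.mem_ofPred_eq] at hG ⊢
    have h1 : ((degN G i : ℝ)) ^ 4 ≤ ((degSum {i} G).ascFactorial 4 : ℝ) := by
      simp only [degSum, Finset.sum_singleton]
      generalize degN G i = D
      simp only [Nat.ascFactorial_succ, Nat.ascFactorial_zero]
      push_cast
      have : (0 : ℝ) ≤ D := by positivity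
      nlinarith [pow_nonneg this 2, pow_nonneg this 3]
    exact (pow_le_pow_left₀ (by positivity) hG 4).trans h1
  refine hsub.trans ?_
  have hn1 : (0 : ℝ) < n := by linarith
  have hpow : (t * √n) ^ 4 = t ^ 4 * (n : ℝ) ^ 2 := by
    rw [mul_pow, show √(n : ℝ) ^ 4 = (√(n : ℝ) ^ 2) ^ 2 by ring, sq_sqrt hn1.le]
  rw [hpow] at hmk ⊢
  rw [mul_comm, ← le_div_iff₀ (by positivity)] at hmk
  refine hmk.trans ?_
  rw [div_mul_div_comm, div_div, div_le_div_iff₀ (by positivity) (by positivity)]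
  have : 0 ≤ t ^ 4 * (i * ((i : ℝ) + 1)) * n := by positivity
  nlinarith

end Moments

/-- Taylor's estimate for `exp (i x)`, `x ≥ 0`, with the sharp remainder. -/
lemma norm_exp_mul_I_sub_sum_le (R : ℕ) {x : ℝ} (hx : 0 ≤ x) :
    ‖Complex.exp (x * Complex.I) -
      ∑ r ∈ Finset.range R, ((x : ℂ) * Complex.I) ^ r / (r.factorial : ℂ)‖ ≤
        x ^ R / R.factorial := by
  induction R generalizing x with
  | zero => simp [Complex.norm_exp_ofReal_mul_I]
  | succ R ih =>
    set f : ℕ → ℝ → ℂ := fun R x => Complex.exp (x * Complex.I) -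
      ∑ r ∈ Finset.range R, ((x : ℂ) * Complex.I) ^ r / (r.factorial : ℂ) with hf
    have hderiv : ∀ y : ℝ, HasDerivAt (f (R + 1)) (Complex.I * f R y) y := by
      intro y
      have h0 : HasDerivAt (fun y : ℝ => (y : ℂ) * Complex.I) Complex.I y := by
        simpa using (Complex.ofRealCLM.hasDerivAt (x := y)).mul_const Complex.I
      have h1 : HasDerivAt (fun y : ℝ => Complex.exp (y * Complex.I))
          (Complex.exp (y * Complex.I) * Complex.I) y := h0.cexp
      have h2 : HasDerivAt (fun y : ℝ => ∑ r ∈ Finset.range (R + 1),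
          ((y : ℂ) * Complex.I) ^ r / (r.factorial : ℂ))
          (∑ r ∈ Finset.range (R + 1),
            (r : ℂ) * ((y : ℂ) * Complex.I) ^ (r - 1) * Complex.I / (r.factorial : ℂ)) y := by
        refine HasDerivAt.fun_sum fun r _ => ?_
        exact (h0.pow r).div_const _
      refine (h1.sub h2).congr_deriv ?_
      simp only [hf]
      rw [Finset.sum_range_succ', mul_sub, Finset.mul_sum, mul_comm]
      congr 1
      simp only [Nat.cast_zero, zero_mul, zero_div, add_zero]
      refine Finset.sum_congr rfl fun r _ => ?_
      rw [Nat.add_sub_cancel, Nat.factorial_succ]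
      push_cast
      have : (r : ℂ) + 1 ≠ 0 := Nat.cast_add_one_ne_zero r
      have : (r.factorial : ℂ) ≠ 0 := Nat.cast_ne_zero.2 (Nat.factorial_ne_zero r)
      field_simp
    have hB : ∀ y : ℝ, HasDerivAt (fun y : ℝ => y ^ (R + 1) / (R + 1).factorial)
        (y ^ R / R.factorial) y := by
      intro y
      refine ((hasDerivAt_pow (R + 1) y).div_const _).congr_deriv ?_
      rw [Nat.add_sub_cancel, Nat.factorial_succ]
      push_cast
      field_simp
    have := image_norm_le_of_norm_deriv_right_le_deriv_boundary (f := f (R + 1))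
      (f' := fun y => Complex.I * f R y) (a := 0) (b := x)
      (fun y _ => (hderiv y).continuousAt.continuousWithinAt)
      (fun y _ => (hderiv y).hasDerivWithinAt)
      (B := fun y => y ^ (R + 1) / (R + 1).factorial) (B' := fun y => y ^ R / R.factorial)
      (by simp [hf, Finset.sum_range_succ'])
      hB (fun y hy => by simpa using ih hy.1) (Set.right_mem_Icc.2 hx)
    exact this

lemma norm_exp_mul_I_sub_sum_le_abs (R : ℕ) (x : ℝ) :
    ‖Complex.exp (x * Complex.I) -
      ∑ r ∈ Finset.range R, ((x : ℂ) * Complex.I) ^ r / (r.factorial : ℂ)‖ ≤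
        |x| ^ R / R.factorial := by
  rcases le_total 0 x with hx | hx
  · simpa [abs_of_nonneg hx] using norm_exp_mul_I_sub_sum_le R hx
  · have h := norm_exp_mul_I_sub_sum_le R (neg_nonneg.2 hx)
    rw [abs_of_nonpos hx, ← Complex.norm_conj]
    convert h using 2
    simp [← Complex.exp_conj, map_sum]

lemma norm_charFun_sub_sum_le {μ : Measure ℝ} [IsProbabilityMeasure μ]
    (h0 : ∀ᵐ x ∂μ, 0 ≤ x) (hInt : ∀ r : ℕ, Integrable (fun x : ℝ => x ^ r) μ) (t : ℝ) (R : ℕ) :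
    ‖charFun μ t - ∑ r ∈ Finset.range R,
      ((t : ℂ) * Complex.I) ^ r / (r.factorial : ℂ) * ((∫ x, x ^ r ∂μ : ℝ) : ℂ)‖ ≤
        |t| ^ R / R.factorial * ∫ x, x ^ R ∂μ := by
  have hIntC : ∀ r : ℕ, Integrable (fun x : ℝ => ((x ^ r : ℝ) : ℂ)) μ := fun r => (hInt r).ofReal
  have hsum : ∑ r ∈ Finset.range R,
      ((t : ℂ) * Complex.I) ^ r / (r.factorial : ℂ) * ((∫ x, x ^ r ∂μ : ℝ) : ℂ) =
      ∫ x, ∑ r ∈ Finset.range R, (((t * x : ℝ) : ℂ) * Complex.I) ^ r / (r.factorial : ℂ) ∂μ := by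
    have e : ∀ (x : ℝ) (r : ℕ), (((t * x : ℝ) : ℂ) * Complex.I) ^ r / (r.factorial : ℂ) =
        ((t : ℂ) * Complex.I) ^ r / (r.factorial : ℂ) * ((x ^ r : ℝ) : ℂ) := by
      intro x r
      push_cast
      ring
    simp_rw [e]
    rw [integral_finsetSum _ fun r _ => (hIntC r).const_mul _]
    refine Finset.sum_congr rfl fun r _ => ?_
    rw [integral_const_mul, integral_complex_ofReal]
  have hexp : Integrable (fun x : ℝ => Complex.exp ((t * x : ℝ) * Complex.I)) μ := by
    refine Integrable.of_bound (C := 1) (by fun_prop) (ae_of_all _ fun x => ?_)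
    rw [Complex.norm_exp_ofReal_mul_I]
  have hpoly : Integrable (fun x : ℝ =>
      ∑ r ∈ Finset.range R, (((t * x : ℝ) : ℂ) * Complex.I) ^ r / (r.factorial : ℂ)) μ := by
    refine integrable_finsetSum _ fun r _ => ?_
    refine ((hIntC r).const_mul (((t : ℂ) * Complex.I) ^ r / (r.factorial : ℂ))).congr
      (ae_of_all _ fun x => ?_)
    push_cast
    ring
  rw [hsum, charFun_apply_real]
  simp_rw [← Complex.ofReal_mul]
  rw [← integral_sub hexp hpoly, ← integral_const_mul]
  refine norm_integral_le_of_norm_le ((hInt R).const_mul _) ?_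
  filter_upwards [h0] with x hx
  refine (norm_exp_mul_I_sub_sum_le_abs R (t * x)).trans_eq ?_
  rw [abs_mul, abs_of_nonneg hx]
  ring

lemma integrable_pow_of_integrable_exp {μ : Measure ℝ}
    (h0 : ∀ᵐ x ∂μ, 0 ≤ x) (hexp : ∀ t : ℝ, Integrable (fun x => exp (t * x)) μ) (r : ℕ) :
    Integrable (fun x : ℝ => x ^ r) μ := by
  refine ((hexp 1).const_mul (r.factorial : ℝ)).mono' (by fun_prop) ?_
  filter_upwards [h0] with x hx
  rw [norm_of_nonneg (by positivity), one_mul]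
  have := pow_div_factorial_le_exp x hx r
  rwa [div_le_iff₀' (by positivity)] at this

/-- The **method of moments** for measures on `[0, ∞)` with a limit that has all exponential
moments. -/
lemma tendsto_charFun_of_tendsto_moments {ν : ℕ → Measure ℝ} [∀ n, IsProbabilityMeasure (ν n)]
    {μ : Measure ℝ} [IsProbabilityMeasure μ]
    (hν0 : ∀ n, ∀ᵐ x ∂ν n, 0 ≤ x) (hν : ∀ n, ∀ r : ℕ, Integrable (fun x : ℝ => x ^ r) (ν n))
    (h0 : ∀ᵐ x ∂μ, 0 ≤ x) (hexp : ∀ t : ℝ, Integrable (fun x => exp (t * x)) μ)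
    (hlim : ∀ r : ℕ, Tendsto (fun n => ∫ x, x ^ r ∂ν n) atTop (nhds (∫ x, x ^ r ∂μ))) (t : ℝ) :
    Tendsto (fun n => charFun (ν n) t) atTop (nhds (charFun μ t)) := by
  have hInt := integrable_pow_of_integrable_exp h0 hexp
  have hsmall : Tendsto (fun R : ℕ => |t| ^ R / R.factorial * ∫ x, x ^ R ∂μ) atTop (nhds 0) := by
    have := tendsto_integral_of_dominated_convergence (μ := μ)
      (F := fun (R : ℕ) x => (|t| * x) ^ R / R.factorial) (f := fun _ => 0)
      (fun x => exp (|t| * x)) (fun R => by fun_prop) (hexp |t|)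
      (fun R => by
        filter_upwards [h0] with x hx
        rw [norm_of_nonneg (by positivity)]
        exact pow_div_factorial_le_exp _ (by positivity) R)
      (ae_of_all _ fun x => FloorSemiring.tendsto_pow_div_factorial_atTop (|t| * x))
    rw [integral_zero] at this
    refine this.congr fun R => ?_
    rw [← integral_const_mul]
    refine integral_congr_ae (ae_of_all _ fun x => ?_)
    simp only
    ring
  rw [Metric.tendsto_atTop]
  intro ε hε
  obtain ⟨R, hR⟩ := ((tendsto_order.1 hsmall).2 (ε / 4) (by positivity)).exists
  set S : (ℕ → ℝ) → ℂ := fun m => ∑ r ∈ Finset.range R,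
      ((t : ℂ) * Complex.I) ^ r / (r.factorial : ℂ) * ((m r : ℝ) : ℂ)
  have hS : Tendsto (fun n => S fun r => ∫ x, x ^ r ∂ν n) atTop
      (nhds (S fun r => ∫ x, x ^ r ∂μ)) := by
    refine tendsto_finsetSum _ fun r _ => ?_
    exact ((Complex.continuous_ofReal.tendsto _).comp (hlim r)).const_mul _
  have hRn : ∀ᶠ n in atTop, |t| ^ R / R.factorial * ∫ x, x ^ R ∂ν n < ε / 4 :=
    (tendsto_order.1 ((hlim R).const_mul (|t| ^ R / (R.factorial : ℝ)))).2 _ hR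
  have hSn := (Metric.tendsto_nhds.1 hS) (ε / 4) (by positivity)
  obtain ⟨N, hN⟩ := eventually_atTop.1 (hRn.and hSn)
  refine ⟨N, fun n hn => ?_⟩
  obtain ⟨h1, h2⟩ := hN n hn
  have b1 := norm_charFun_sub_sum_le (hν0 n) (hν n) t R
  have b2 := norm_charFun_sub_sum_le h0 hInt t R
  rw [dist_eq_norm] at h2 ⊢
  have : charFun (ν n) t - charFun μ t = (charFun (ν n) t - S fun r => ∫ x, x ^ r ∂ν n) +
      ((S fun r => ∫ x, x ^ r ∂ν n) - S fun r => ∫ x, x ^ r ∂μ) -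
      (charFun μ t - S fun r => ∫ x, x ^ r ∂μ) := by ring
  rw [this]
  refine (norm_sub_le _ _).trans_lt ?_
  have := norm_add_le (charFun (ν n) t - S fun r => ∫ x, x ^ r ∂ν n)
      ((S fun r => ∫ x, x ^ r ∂ν n) - S fun r => ∫ x, x ^ r ∂μ)
  linarith

lemma tendsto_real_Ici_of_tendsto_moments {ν : ℕ → Measure ℝ} [∀ n, IsProbabilityMeasure (ν n)]
    {μ : Measure ℝ} [IsProbabilityMeasure μ]
    (hν0 : ∀ n, ∀ᵐ x ∂ν n, 0 ≤ x) (hν : ∀ n, ∀ r : ℕ, Integrable (fun x : ℝ => x ^ r) (ν n))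
    (h0 : ∀ᵐ x ∂μ, 0 ≤ x) (hexp : ∀ t : ℝ, Integrable (fun x => exp (t * x)) μ)
    (hlim : ∀ r : ℕ, Tendsto (fun n => ∫ x, x ^ r ∂ν n) atTop (nhds (∫ x, x ^ r ∂μ))) {t : ℝ}
    (ht : μ {t} = 0) :
    Tendsto (fun n => (ν n).real (Set.Ici t)) atTop (nhds (μ.real (Set.Ici t))) := by
  let νP : ℕ → ProbabilityMeasure ℝ := fun n => ⟨ν n, inferInstance⟩
  let μP : ProbabilityMeasure ℝ := ⟨μ, inferInstance⟩
  have hw : Tendsto νP atTop (nhds μP) :=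
    ProbabilityMeasure.tendsto_of_tendsto_charFun (μ := νP) (μ₀ := μP)
      (tendsto_charFun_of_tendsto_moments hν0 hν h0 hexp hlim)
  have := ProbabilityMeasure.tendsto_measure_of_null_frontier_of_tendsto' hw (E := Set.Ici t)
    (by rw [frontier_Ici]; exact ht)
  exact (ENNReal.tendsto_toReal (measure_ne_top μ _)).comp this

lemma Gamma_duplication_nat (a r : ℕ) (ha : 1 ≤ a) :
    Gamma ((a : ℝ) + r / 2) * Gamma ((a : ℝ) + 1 / 2 + r / 2) * (2 ^ (2 * a) * 2 ^ r) =
      2 * √π * Gamma (2 * a + r) := by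
  have h := Gamma_mul_Gamma_add_half ((a : ℝ) + r / 2)
  rw [show (a : ℝ) + r / 2 + 1 / 2 = a + 1 / 2 + r / 2 by ring,
    show 2 * ((a : ℝ) + r / 2) = 2 * a + r by ring] at h
  rw [h, rpow_sub two_pos, rpow_one,
    show 2 * (a : ℝ) + r = ((2 * a + r : ℕ) : ℝ) by push_cast; ring,
    rpow_natCast, pow_add]
  field_simp

lemma Gamma_natCast_add {d : ℕ} (hd : 1 ≤ d) (r : ℕ) :
    Gamma ((d : ℝ) + r) = d.ascFactorial r * Gamma d := by
  induction r with
  | zero => simp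
  | succ r ih =>
    have : (0 : ℝ) < d := by exact_mod_cast hd
    rw [Nat.cast_succ, ← add_assoc, Gamma_add_one (by positivity), ih, Nat.ascFactorial_succ]
    push_cast
    ring

/-- The density of the limit of the rescaled total degree of a seed with `a` edges. -/
def seedPDF (a : ℕ) (y : ℝ) : ℝ :=
  1 / (2 ^ (2 * a) * Gamma ((a : ℝ) + 1 / 2)) * (y ^ (2 * a) * exp (-y ^ 2 / 4))

/-- The law of the limit of the rescaled total degree of a seed with `a` edges. -/
def seedLaw (a : ℕ) : Measure ℝ :=
  (volume.restrict (Set.Ioi 0)).withDensity fun y => ENNReal.ofReal (seedPDF a y)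

lemma seedPDF_nonneg (a : ℕ) (y : ℝ) : 0 ≤ seedPDF a y := by
  have : 0 < Gamma ((a : ℝ) + 1 / 2) := Gamma_pos_of_pos (by positivity)
  have : 0 ≤ y ^ (2 * a) := (even_two_mul a).pow_nonneg y
  unfold seedPDF
  positivity

lemma measurable_seedPDF (a : ℕ) : Measurable (seedPDF a) := by
  unfold seedPDF; fun_prop

lemma integral_seedLaw (a : ℕ) (f : ℝ → ℝ) :
    ∫ y, f y ∂seedLaw a = ∫ y in Set.Ioi 0, seedPDF a y * f y := by
  rw [seedLaw, integral_withDensity_eq_integral_toReal_smul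
    (by have := measurable_seedPDF a; fun_prop) (ae_of_all _ fun _ => ENNReal.ofReal_lt_top)]
  simp [ENNReal.toReal_ofReal (seedPDF_nonneg a _)]

lemma integral_pow_mul_exp_neg_sq (q : ℕ) :
    ∫ y in Set.Ioi (0 : ℝ), y ^ q * exp (-y ^ 2 / 4) = 2 ^ q * Gamma (((q : ℝ) + 1) / 2) := by
  have h := integral_rpow_mul_exp_neg_mul_rpow (p := 2) (q := q) (b := 1 / 4) (by norm_num)
    (by have : (0 : ℝ) ≤ q := by positivity
        linarith) (by norm_num)
  have e : (1 / 4 : ℝ) ^ (-((q : ℝ) + 1) / 2) = 2 ^ q * 2 := by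
    rw [show (1 / 4 : ℝ) = 2 ^ (-2 : ℝ) by rw [rpow_neg two_pos.le]; norm_num,
      ← rpow_mul two_pos.le, show (-2 : ℝ) * (-((q : ℝ) + 1) / 2) = ((q + 1 : ℕ) : ℝ) by
        push_cast; ring, rpow_natCast, pow_succ]
  rw [e] at h
  rw [show (2 : ℝ) ^ q * Gamma (((q : ℝ) + 1) / 2) =
    2 ^ q * 2 * (1 / 2) * Gamma (((q : ℝ) + 1) / 2) by ring, ← h]
  refine setIntegral_congr_fun measurableSet_Ioi fun y _ => ?_
  simp only [rpow_natCast, rpow_two]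
  congr 2
  ring

lemma integral_seedLaw_pow (a r : ℕ) :
    ∫ y, y ^ r ∂seedLaw a = 2 ^ r * Gamma ((a : ℝ) + 1 / 2 + r / 2) / Gamma ((a : ℝ) + 1 / 2) := by
  have hG : 0 < Gamma ((a : ℝ) + 1 / 2) := Gamma_pos_of_pos (by positivity)
  have h := integral_pow_mul_exp_neg_sq (2 * a + r)
  rw [integral_seedLaw]
  have e : ∀ y : ℝ, seedPDF a y * y ^ r = 1 / (2 ^ (2 * a) * Gamma ((a : ℝ) + 1 / 2)) *
      (y ^ (2 * a + r) * exp (-y ^ 2 / 4)) := by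
    intro y
    rw [seedPDF, pow_add]
    ring
  simp_rw [e]
  rw [integral_const_mul, h, show (((2 * a + r : ℕ) : ℝ) + 1) / 2 = (a : ℝ) + 1 / 2 + r / 2 by
    push_cast; ring, pow_add]
  field_simp

lemma integrableOn_pow_mul_exp_neg_sq (q : ℕ) :
    IntegrableOn (fun y : ℝ => y ^ q * exp (-y ^ 2 / 8)) (Set.Ioi 0) := by
  have := (integrable_rpow_mul_exp_neg_mul_sq (b := 1 / 8) (by norm_num) (s := q)
    (by have : (0 : ℝ) ≤ q := by positivity
        linarith)).integrableOn (s := Set.Ioi 0)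
  refine this.congr (ae_of_all _ fun y => ?_)
  simp only [rpow_natCast]
  congr 2
  ring

lemma integrable_exp_seedLaw (a : ℕ) (t : ℝ) : Integrable (fun y => exp (t * y)) (seedLaw a) := by
  rw [seedLaw, integrable_withDensity_iff_integrable_smul₀'
    (by have := measurable_seedPDF a; fun_prop) (ae_of_all _ fun _ => ENNReal.ofReal_lt_top)]
  simp_rw [ENNReal.toReal_ofReal (seedPDF_nonneg a _), smul_eq_mul]
  have hG : 0 < Gamma ((a : ℝ) + 1 / 2) := Gamma_pos_of_pos (by positivity)
  refine ((integrableOn_pow_mul_exp_neg_sq (2 * a)).const_mul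
    (1 / (2 ^ (2 * a) * Gamma ((a : ℝ) + 1 / 2)) * exp (2 * t ^ 2))).mono'
    (by have := measurable_seedPDF a; fun_prop) (ae_of_all _ fun y => ?_)
  have h0 := seedPDF_nonneg a y
  rw [norm_of_nonneg (by positivity), seedPDF]
  have : exp (-y ^ 2 / 4) * exp (t * y) ≤ exp (2 * t ^ 2) * exp (-y ^ 2 / 8) := by
    rw [← exp_add, ← exp_add]
    refine exp_le_exp.2 ?_
    nlinarith [sq_nonneg (y - 4 * t)]
  have hy : 0 ≤ y ^ (2 * a) := (even_two_mul a).pow_nonneg y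
  calc _ = 1 / (2 ^ (2 * a) * Gamma ((a : ℝ) + 1 / 2)) * y ^ (2 * a) *
        (exp (-y ^ 2 / 4) * exp (t * y)) := by ring
    _ ≤ 1 / (2 ^ (2 * a) * Gamma ((a : ℝ) + 1 / 2)) * y ^ (2 * a) *
        (exp (2 * t ^ 2) * exp (-y ^ 2 / 8)) := by gcongr
    _ = _ := by ring

instance isProbabilityMeasure_seedLaw (a : ℕ) : IsProbabilityMeasure (seedLaw a) := by
  have hfin : IsFiniteMeasure (seedLaw a) := by
    have h := integrable_exp_seedLaw a 0
    simp only [zero_mul, exp_zero] at h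
    exact (integrable_const_iff_isFiniteMeasure one_ne_zero).1 h
  have h := integral_seedLaw_pow a 0
  have hG : 0 < Gamma ((a : ℝ) + 1 / 2) := Gamma_pos_of_pos (by positivity)
  simp only [pow_zero, integral_const, smul_eq_mul, mul_one, Nat.cast_zero, zero_div, add_zero,
    one_mul, div_self hG.ne'] at h
  constructor
  rw [← ENNReal.toReal_eq_one_iff]
  exact h

lemma ae_seedLaw_pos (a : ℕ) : ∀ᵐ y ∂seedLaw a, 0 < y :=
  (withDensity_absolutelyContinuous _ _).ae_le (ae_restrict_mem measurableSet_Ioi)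

instance nullSingletonClass_seedLaw (a : ℕ) : NullSingletonClass (seedLaw a) := by
  unfold seedLaw; infer_instance

/-- The moments of the seed law are the limits of the rescaled total degrees of the seed. -/
lemma integral_seedLaw_pow_eq_limMoment {k : ℕ} (hk : 2 ≤ k) (r : ℕ) :
    ∫ y, y ^ r ∂seedLaw (k - 1) = limMoment k (2 * (k - 1)) r := by
  obtain ⟨a, rfl⟩ : ∃ a, k = a + 1 := ⟨k - 1, by omega⟩
  have ha : (0 : ℝ) < a := Nat.cast_pos.2 (by omega)
  rw [Nat.add_sub_cancel, integral_seedLaw_pow, limMoment]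
  have h1 := Gamma_duplication_nat a r (by omega)
  have h0 := Gamma_duplication_nat a 0 (by omega)
  have h2 := Gamma_natCast_add (d := 2 * a) (by omega) r
  push_cast at h0 h1 h2 ⊢
  rw [h2] at h1
  simp only [zero_div, add_zero, pow_zero, mul_one] at h0
  rw [add_sub_cancel_right]
  have g1 : 0 < Gamma ((a : ℝ) + 1 / 2) := Gamma_pos_of_pos (by positivity)
  have g2 : 0 < Gamma ((a : ℝ) + r / 2) := Gamma_pos_of_pos (by positivity)
  have g3 : 0 < Gamma (2 * (a : ℝ)) := Gamma_pos_of_pos (by positivity)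
  rw [div_eq_div_iff g1.ne' g2.ne']
  have h3 : (2 : ℝ) ^ (2 * a) ≠ 0 := by positivity
  refine mul_left_cancel₀ h3 ?_
  linear_combination h1 - ((2 * a).ascFactorial r : ℝ) * h0

open ProbabilityTheory in
lemma integral_betaMeasure {d b : ℕ} (hd : 1 ≤ d) (hb : 1 ≤ b) (f : ℝ → ℝ) :
    ∫ x, f x ∂betaMeasure d b =
      ∫ x in Set.Ioo 0 1, 1 / beta d b * (x ^ (d - 1) * (1 - x) ^ (b - 1)) * f x := by
  have hb0 : 0 < beta d b := beta_pos (by exact_mod_cast hd) (by exact_mod_cast hb)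
  have h : ∀ x, betaPDFReal d b x = Set.indicator (Set.Ioo 0 1)
      (fun x => 1 / beta d b * (x ^ (d - 1) * (1 - x) ^ (b - 1))) x := by
    intro x
    rw [betaPDFReal, Set.indicator_apply]
    refine if_congr Iff.rfl ?_ rfl
    rw [← rpow_natCast, ← rpow_natCast, Nat.cast_pred hd, Nat.cast_pred hb, mul_assoc]
  have h0 : ∀ x, 0 ≤ betaPDFReal d b x := by
    intro x
    rw [h, Set.indicator_apply]
    split_ifs with hx
    · have := hx.1.le
      have : 0 ≤ 1 - x := sub_nonneg.2 hx.2.le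
      positivity
    · exact le_rfl
  rw [betaMeasure, show betaPDF d b = fun x => ENNReal.ofReal (betaPDFReal d b x) from rfl,
    integral_withDensity_eq_integral_toReal_smul (by fun_prop)
    (ae_of_all _ fun _ => ENNReal.ofReal_lt_top)]
  simp_rw [ENNReal.toReal_ofReal (h0 _), h, smul_eq_mul]
  rw [← integral_indicator measurableSet_Ioo]
  congr 1
  ext x
  by_cases hx : x ∈ Set.Ioo (0 : ℝ) 1 <;> simp [hx]

open ProbabilityTheory in
lemma integral_betaMeasure_pow {d b : ℕ} (hd : 1 ≤ d) (hb : 1 ≤ b) (r : ℕ) :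
    ∫ x, x ^ r ∂betaMeasure d b = beta ((d + r : ℕ) : ℝ) b / beta d b := by
  have hb0 : 0 < beta ((d + r : ℕ) : ℝ) b :=
    beta_pos (by exact_mod_cast (by omega : 0 < d + r)) (by exact_mod_cast hb)
  have := isProbabilityMeasureBeta (α := ((d + r : ℕ) : ℝ)) (β := b)
    (by exact_mod_cast (by omega : 0 < d + r)) (by exact_mod_cast hb)
  have h1 := integral_betaMeasure (d := d + r) (by omega) hb (fun _ => 1)
  simp only [integral_const, probReal_univ, smul_eq_mul, mul_one] at h1
  rw [integral_const_mul] at h1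
  rw [integral_betaMeasure hd hb]
  have e : ∀ x : ℝ, 1 / beta d b * (x ^ (d - 1) * (1 - x) ^ (b - 1)) * x ^ r =
      1 / beta d b * (x ^ (d + r - 1) * (1 - x) ^ (b - 1)) := by
    intro x
    rw [show d + r - 1 = d - 1 + r by omega, pow_add]
    ring
  simp_rw [e]
  rw [integral_const_mul]
  field_simp at h1
  rw [← h1, div_mul_eq_mul_div, one_mul]

open ProbabilityTheory in
lemma ae_betaMeasure_mem_Ioo (d b : ℝ) : ∀ᵐ x ∂betaMeasure d b, x ∈ Set.Ioo (0 : ℝ) 1 := by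
  rw [betaMeasure, ae_withDensity_iff (by unfold betaPDF; fun_prop)]
  refine ae_of_all _ fun x hx => ?_
  by_contra hx'
  exact hx ((congrArg ENNReal.ofReal (if_neg hx')).trans ENNReal.ofReal_zero)

open ProbabilityTheory in
lemma betaMeasure_real_Ici {d b : ℕ} (hd : 1 ≤ d) (hb : 1 ≤ b) {v : ℝ} (hv : 0 < v) (hv' : v < 1) :
    (betaMeasure d b).real (Set.Ici (1 - v)) =
      1 / beta d b * ∫ x in (1 - v)..1, x ^ (d - 1) * (1 - x) ^ (b - 1) := by
  rw [← integral_indicator_one measurableSet_Ici, integral_betaMeasure hd hb,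
    intervalIntegral.integral_of_le (by linarith), integral_Ioc_eq_integral_Ioo,
    ← integral_Ico_eq_integral_Ioo (x := 1 - v), ← integral_const_mul,
    ← integral_indicator measurableSet_Ioo,
    ← integral_indicator measurableSet_Ico]
  congr 1
  ext x
  simp only [Set.indicator_apply, Set.mem_Ioo, Set.mem_Ico, Set.mem_Ici, Pi.one_apply]
  by_cases h1 : 1 - v ≤ x <;> by_cases h2 : x < 1
  · simp [h1, h2, show 0 < x by linarith]
  all_goals simp [h1, h2]

lemma integral_one_sub_pow {b : ℕ} (hb : 1 ≤ b) (v : ℝ) :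
    ∫ x in (1 - v)..1, (1 - x) ^ (b - 1) = v ^ b / b := by
  rw [intervalIntegral.integral_comp_sub_left (fun x : ℝ => x ^ (b - 1)) 1, integral_pow]
  rw [Nat.cast_pred hb, Nat.sub_add_cancel hb]
  simp [show b ≠ 0 by omega]

open ProbabilityTheory in
lemma betaMeasure_real_Ici_le {d b : ℕ} (hd : 1 ≤ d) (hb : 1 ≤ b) {v : ℝ} (hv : 0 < v)
    (hv' : v < 1) : (betaMeasure d b).real (Set.Ici (1 - v)) ≤ 1 / (b * beta d b) * v ^ b := by
  have hb0 : 0 < beta d b := beta_pos (by exact_mod_cast hd) (by exact_mod_cast hb)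
  have hb1 : (0 : ℝ) < b := by exact_mod_cast hb
  have : ∫ x in (1 - v)..1, x ^ (d - 1) * (1 - x) ^ (b - 1) ≤ v ^ b / b := by
    rw [← integral_one_sub_pow hb]
    refine intervalIntegral.integral_mono_on (by linarith)
      (Continuous.intervalIntegrable (by fun_prop) _ _)
      (Continuous.intervalIntegrable (by fun_prop) _ _) fun x hx => ?_
    have h0 : 0 ≤ x := by linarith [hx.1]
    have h1 : 0 ≤ 1 - x := by linarith [hx.2]
    exact mul_le_of_le_one_left (by positivity) (pow_le_one₀ h0 hx.2)
  rw [betaMeasure_real_Ici hd hb hv hv']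
  calc _ ≤ 1 / beta d b * (v ^ b / b) := by gcongr
    _ = _ := by field_simp

open ProbabilityTheory in
lemma le_betaMeasure_real_Ici {d b : ℕ} (hd : 1 ≤ d) (hb : 1 ≤ b) {v : ℝ} (hv : 0 < v)
    (hv' : v < 1) : 1 / (b * beta d b) * (v ^ b * (1 - v) ^ (d - 1)) ≤
      (betaMeasure d b).real (Set.Ici (1 - v)) := by
  have hb0 : 0 < beta d b := beta_pos (by exact_mod_cast hd) (by exact_mod_cast hb)
  have hb1 : (0 : ℝ) < b := by exact_mod_cast hb
  have : (1 - v) ^ (d - 1) * (v ^ b / b) ≤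
      ∫ x in (1 - v)..1, x ^ (d - 1) * (1 - x) ^ (b - 1) := by
    rw [← integral_one_sub_pow hb, ← intervalIntegral.integral_const_mul]
    refine intervalIntegral.integral_mono_on (by linarith)
      (Continuous.intervalIntegrable (by fun_prop) _ _)
      (Continuous.intervalIntegrable (by fun_prop) _ _) fun x hx => ?_
    have h0 : 0 ≤ 1 - v := by linarith
    have h1 : 0 ≤ 1 - x := by linarith [hx.2]
    gcongr
    exact hx.1
  rw [betaMeasure_real_Ici hd hb hv hv']
  calc _ = 1 / beta d b * ((1 - v) ^ (d - 1) * (v ^ b / b)) := by field_simp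
    _ ≤ _ := by gcongr

/-- The law of the limit of the rescaled degree of a vertex having degree `d` in a tree with `a`
edges, where the remaining total degree is `b`. -/
def degreeLaw (a d b : ℕ) : Measure ℝ :=
  ((ProbabilityTheory.betaMeasure d b).prod (seedLaw a)).map fun p => p.1 * p.2

lemma isProbabilityMeasure_betaMeasure {d b : ℕ} (hd : 1 ≤ d) (hb : 1 ≤ b) :
    IsProbabilityMeasure (ProbabilityTheory.betaMeasure d b) :=
  ProbabilityTheory.isProbabilityMeasureBeta (by exact_mod_cast hd) (by exact_mod_cast hb)

lemma isProbabilityMeasure_degreeLaw {a d b : ℕ} (hd : 1 ≤ d) (hb : 1 ≤ b) :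
    IsProbabilityMeasure (degreeLaw a d b) := by
  have := isProbabilityMeasure_betaMeasure hd hb
  exact Measure.isProbabilityMeasure_map (by fun_prop)

lemma ae_prod_betaMeasure_seedLaw {a d b : ℕ} (hd : 1 ≤ d) (hb : 1 ≤ b) :
    ∀ᵐ p ∂(ProbabilityTheory.betaMeasure d b).prod (seedLaw a),
      p.1 ∈ Set.Ioo (0 : ℝ) 1 ∧ 0 < p.2 := by
  have := isProbabilityMeasure_betaMeasure hd hb
  exact (Measure.quasiMeasurePreserving_fst.ae (ae_betaMeasure_mem_Ioo d b)).and
    (Measure.quasiMeasurePreserving_snd.ae (ae_seedLaw_pos a))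

lemma ae_degreeLaw_nonneg {a d b : ℕ} (hd : 1 ≤ d) (hb : 1 ≤ b) :
    ∀ᵐ x ∂degreeLaw a d b, 0 ≤ x := by
  rw [degreeLaw, ae_map_iff (by fun_prop) measurableSet_Ici]
  filter_upwards [ae_prod_betaMeasure_seedLaw hd hb] with p hp
  exact mul_nonneg hp.1.1.le hp.2.le

lemma integrable_exp_degreeLaw {a d b : ℕ} (hd : 1 ≤ d) (hb : 1 ≤ b) (t : ℝ) :
    Integrable (fun x => exp (t * x)) (degreeLaw a d b) := by
  have := isProbabilityMeasure_betaMeasure hd hb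
  rw [degreeLaw, integrable_map_measure (by fun_prop) (by fun_prop)]
  refine ((integrable_exp_seedLaw a |t|).comp_snd (ProbabilityTheory.betaMeasure d b)).mono'
    (by fun_prop) ?_
  filter_upwards [ae_prod_betaMeasure_seedLaw hd hb] with p hp
  rw [Function.comp_apply, norm_of_nonneg (exp_pos _).le, exp_le_exp]
  have h1 := hp.1.1.le
  have h2 := hp.2.le
  calc t * (p.1 * p.2) ≤ |t| * (p.1 * p.2) := by gcongr; exact le_abs_self t
    _ ≤ |t| * p.2 := by gcongr; exact mul_le_of_le_one_left h2 hp.1.2.le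

/-- The moments of the degree law are the limits of those of the rescaled degrees. -/
lemma integral_degreeLaw_pow {k d b : ℕ} (hk : 2 ≤ k) (hd : 1 ≤ d) (hb : 1 ≤ b)
    (hdb : d + b = 2 * (k - 1)) (r : ℕ) :
    ∫ x, x ^ r ∂degreeLaw (k - 1) d b = limMoment k d r := by
  have := isProbabilityMeasure_betaMeasure hd hb
  rw [degreeLaw, integral_map (by fun_prop) (by fun_prop)]
  simp_rw [mul_pow]
  rw [integral_prod_mul (fun x : ℝ => x ^ r) fun x : ℝ => x ^ r, integral_betaMeasure_pow hd hb,
    integral_seedLaw_pow_eq_limMoment hk, limMoment, limMoment, ← hdb,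
    ProbabilityTheory.beta, ProbabilityTheory.beta]
  have h1 := Gamma_natCast_add hd r
  have h2 := Gamma_natCast_add (d := d + b) (by omega) r
  rw [show (((d + r : ℕ) : ℝ) + b) = ((d + b : ℕ) : ℝ) + r by push_cast; ring,
    Nat.cast_add d r, h1, h2, ← Nat.cast_add]
  have g1 : 0 < Gamma (d : ℝ) := Gamma_pos_of_pos (by exact_mod_cast hd)
  have g2 : 0 < Gamma (b : ℝ) := Gamma_pos_of_pos (by exact_mod_cast hb)
  have g3 : 0 < Gamma ((d + b : ℕ) : ℝ) :=
    Gamma_pos_of_pos (by exact_mod_cast (by omega : 0 < d + b))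
  have g4 : 0 < ((d + b).ascFactorial r : ℝ) := by
    obtain ⟨j, hj⟩ : ∃ j, d + b = j + 1 := ⟨d + b - 1, by omega⟩
    rw [hj]
    exact_mod_cast Nat.ascFactorial_pos _ _
  field_simp

lemma degreeLaw_real_eq {a d b : ℕ} (hd : 1 ≤ d) (hb : 1 ≤ b) {s : Set ℝ}
    (hs : MeasurableSet s) :
    (degreeLaw a d b).real s =
      ∫ y, (ProbabilityTheory.betaMeasure d b).real {x | x * y ∈ s} ∂seedLaw a := by
  have := isProbabilityMeasure_betaMeasure hd hb
  have := isProbabilityMeasure_degreeLaw (a := a) hd hb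
  have hm : Measurable (s.indicator (1 : ℝ → ℝ)) := measurable_one.indicator hs
  rw [← integral_indicator_one hs, degreeLaw, integral_map (by fun_prop) (by fun_prop),
    integral_prod_symm]
  · refine integral_congr_ae (ae_of_all _ fun y => ?_)
    have hy : MeasurableSet {x | x * y ∈ s} := hs.preimage (by fun_prop)
    exact integral_indicator_one hy
  · refine Integrable.of_bound (C := 1)
      (hm.comp (by fun_prop : Measurable fun p : ℝ × ℝ => p.1 * p.2)).aestronglyMeasurable
      (ae_of_all _ fun p => ?_)
    by_cases h : p.1 * p.2 ∈ s <;> simp [h]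

lemma degreeLaw_singleton {a d b : ℕ} (hd : 1 ≤ d) (hb : 1 ≤ b) (t : ℝ) :
    degreeLaw a d b {t} = 0 := by
  have := isProbabilityMeasure_degreeLaw (a := a) hd hb
  have h : (degreeLaw a d b).real {t} = 0 := by
    rw [degreeLaw_real_eq hd hb (measurableSet_singleton t)]
    refine integral_eq_zero_of_ae ?_
    filter_upwards [ae_seedLaw_pos a] with y hy
    have e : {x | x * y ∈ ({t} : Set ℝ)} = {t / y} := by
      ext x
      simp [eq_div_iff hy.ne']
    have hv : volume ({t / y} : Set ℝ) = 0 := by simp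
    rw [e, measureReal_def, ProbabilityTheory.betaMeasure,
      withDensity_absolutelyContinuous _ _ hv]
    rfl
  rwa [measureReal_eq_zero_iff] at h

/-- The tail of the degree law in terms of the tail of the beta distribution. -/
lemma degreeLaw_real_Ici {a d b : ℕ} (hd : 1 ≤ d) (hb : 1 ≤ b) {t : ℝ} (ht : 0 < t) :
    (degreeLaw a d b).real (Set.Ici t) = ∫ x in Set.Ioi 0,
      seedPDF a (t + x) *
        (ProbabilityTheory.betaMeasure d b).real (Set.Ici (1 - x / (t + x))) := by
  have := isProbabilityMeasure_betaMeasure hd hb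
  rw [degreeLaw_real_eq hd hb measurableSet_Ici, integral_seedLaw]
  set f : ℝ → ℝ := fun y => seedPDF a y *
    (ProbabilityTheory.betaMeasure d b).real {x | x * y ∈ Set.Ici t}
  have h1 : ∫ y in Set.Ioi 0, f y = ∫ y in Set.Ioi t, f y := by
    refine setIntegral_eq_of_subset_of_forall_sdiff_eq_zero measurableSet_Ioi
      (Set.Ioi_subset_Ioi ht.le) fun y hy => ?_
    have hy0 : 0 < y := hy.1
    have hyt : y ≤ t := not_lt.1 hy.2
    have : (ProbabilityTheory.betaMeasure d b).real {x | x * y ∈ Set.Ici t} = 0 := by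
      rw [measureReal_eq_zero_iff, measure_eq_zero_iff_ae_notMem]
      filter_upwards [ae_betaMeasure_mem_Ioo d b] with x hx hxy
      have : t ≤ x * y := hxy
      nlinarith [hx.2]
    simp only [f, this, mul_zero]
  rw [h1]
  have h2 := (measurePreserving_add_left volume t).setIntegral_preimage_emb
    (measurableEmbedding_addLeft t) f (Set.Ioi t)
  rw [← h2, show (fun x => t + x) ⁻¹' Set.Ioi t = Set.Ioi 0 by ext; simp]
  refine setIntegral_congr_fun measurableSet_Ioi fun x hx => ?_
  have hx : 0 < x := hx
  simp only [f]
  congr 2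
  ext z
  rw [one_sub_div (by positivity), add_sub_cancel_right]
  simp only [Set.mem_ofPred_eq, Set.mem_Ici]
  rw [div_le_iff₀ (by positivity)]

lemma integrableOn_one_add_pow_mul_exp (p b : ℕ) :
    IntegrableOn (fun w : ℝ => (1 + w) ^ p * w ^ b * exp (-w / 2)) (Set.Ioi 0) := by
  have h : ∀ q : ℕ, IntegrableOn (fun w : ℝ => w ^ q * exp (-w / 2)) (Set.Ioi 0) := by
    intro q
    refine (integrableOn_rpow_mul_exp_neg_mul_rpow (p := 1) (s := q) (b := 1 / 2)
      (by have : (0 : ℝ) ≤ q := by positivity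
          linarith) one_pos (by norm_num)).congr_fun (fun w _ => ?_) measurableSet_Ioi
    simp only [rpow_natCast, rpow_one]
    congr 2
    ring
  refine (((h b).add (h (p + b))).const_mul (2 ^ (p - 1))).mono' (by fun_prop)
    ((ae_restrict_mem measurableSet_Ioi).mono fun w hw => ?_)
  have hw : 0 < w := hw
  rw [norm_of_nonneg (by positivity)]
  have := add_pow_le zero_le_one hw.le p
  rw [one_pow] at this
  calc _ ≤ 2 ^ (p - 1) * (1 + w ^ p) * w ^ b * exp (-w / 2) := by gcongr
    _ = _ := by simp only [Pi.add_apply, pow_add]; ring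

lemma integral_pow_mul_exp_neg_half (b : ℕ) :
    ∫ w in Set.Ioi (0 : ℝ), w ^ b * exp (-w / 2) = 2 ^ (b + 1) * b.factorial := by
  have h := integral_rpow_mul_exp_neg_mul_Ioi (a := b + 1) (r := 1 / 2) (by positivity)
    (by norm_num)
  rw [Gamma_nat_eq_factorial, add_sub_cancel_right, one_div_one_div, ← Nat.cast_succ,
    rpow_natCast] at h
  rw [← h]
  refine setIntegral_congr_fun measurableSet_Ioi fun w _ => ?_
  simp only [rpow_natCast]
  congr 2
  ring

lemma setIntegral_Ioi_eq_comp_div (g : ℝ → ℝ) {t : ℝ} (ht : 0 < t) :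
    ∫ x in Set.Ioi 0, g x = t⁻¹ * ∫ w in Set.Ioi 0, g (w / t) := by
  have h := integral_comp_mul_left_Ioi g 0 (inv_pos.2 ht)
  rw [mul_zero, inv_inv, smul_eq_mul] at h
  simp_rw [div_eq_inv_mul]
  rw [h, inv_mul_cancel_left₀ ht.ne']

/-- A Gaussian tail integral with polynomial weights. -/
def tailIntegral (p b : ℕ) (t : ℝ) : ℝ :=
  ∫ x in Set.Ioi 0, (t + x) ^ p * x ^ b * exp (-(t + x) ^ 2 / 4)

lemma integrableOn_tailIntegral (p b : ℕ) {t : ℝ} (ht : 0 ≤ t) :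
    IntegrableOn (fun x => (t + x) ^ p * x ^ b * exp (-(t + x) ^ 2 / 4)) (Set.Ioi 0) := by
  have h1 := (integrableOn_pow_mul_exp_neg_sq (p + b)).mono_set (Set.Ioi_subset_Ioi ht)
  rw [← (measurePreserving_add_left volume t).integrableOn_comp_preimage
    (measurableEmbedding_addLeft t), show (fun x => t + x) ⁻¹' Set.Ioi t = Set.Ioi 0 by ext; simp]
    at h1
  refine h1.mono' (by fun_prop) ((ae_restrict_mem measurableSet_Ioi).mono fun x hx => ?_)
  have hx : 0 < x := hx
  rw [norm_of_nonneg (by positivity), Function.comp_apply, pow_add]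
  have : exp (-(t + x) ^ 2 / 4) ≤ exp (-(t + x) ^ 2 / 8) := by
    refine exp_le_exp.2 ?_
    have := sq_nonneg (t + x)
    linarith
  gcongr
  linarith

lemma tailIntegral_nonneg (p b : ℕ) {t : ℝ} (ht : 0 ≤ t) : 0 ≤ tailIntegral p b t := by
  refine setIntegral_nonneg measurableSet_Ioi fun x hx => ?_
  have hx : 0 < x := hx
  positivity

lemma tailIntegral_eq (p b : ℕ) {t : ℝ} (ht : 0 < t) :
    tailIntegral p b t = t ^ p / t ^ (b + 1) * exp (-t ^ 2 / 4) * ∫ w in Set.Ioi 0,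
      (1 + w / t ^ 2) ^ p * w ^ b * exp (-w / 2) * exp (-(w / t) ^ 2 / 4) := by
  rw [tailIntegral, setIntegral_Ioi_eq_comp_div _ ht, ← integral_const_mul, ← integral_const_mul]
  refine setIntegral_congr_fun measurableSet_Ioi fun w _ => ?_
  have e1 : t + w / t = t * (1 + w / t ^ 2) := by field_simp
  have e2 : exp (-(t + w / t) ^ 2 / 4) =
      exp (-t ^ 2 / 4) * (exp (-w / 2) * exp (-(w / t) ^ 2 / 4)) := by
    rw [← exp_add, ← exp_add]
    congr 1
    field_simp
    ring
  simp only [e2]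
  rw [e1, mul_pow, div_pow, pow_succ]
  field_simp
  ring

lemma tendsto_tailIntegral (p b : ℕ) :
    Tendsto (fun t => tailIntegral p b t / (t ^ p / t ^ (b + 1) * exp (-t ^ 2 / 4))) atTop
      (nhds (2 ^ (b + 1) * b.factorial)) := by
  have h : Tendsto (fun t : ℝ => ∫ w in Set.Ioi 0,
      (1 + w / t ^ 2) ^ p * w ^ b * exp (-w / 2) * exp (-(w / t) ^ 2 / 4)) atTop
      (nhds (∫ w in Set.Ioi (0 : ℝ), w ^ b * exp (-w / 2))) := by
    refine tendsto_integral_filter_of_dominated_convergence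
      (fun w => (1 + w) ^ p * w ^ b * exp (-w / 2)) (Eventually.of_forall fun t => by fun_prop)
      ?_ (integrableOn_one_add_pow_mul_exp p b) (ae_of_all _ fun w => ?_)
    · filter_upwards [eventually_ge_atTop 1] with t ht
      refine (ae_restrict_mem measurableSet_Ioi).mono fun w hw => ?_
      have hw : 0 < w := hw
      rw [norm_of_nonneg (by positivity)]
      have h1 : exp (-(w / t) ^ 2 / 4) ≤ 1 :=
        exp_le_one_iff.2 (by have := sq_nonneg (w / t); linarith)
      have h2 : w / t ^ 2 ≤ w := div_le_self hw.le (one_le_pow₀ ht)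
      calc _ ≤ (1 + w) ^ p * w ^ b * exp (-w / 2) * 1 := by gcongr
        _ = _ := mul_one _
    · have h1 : Tendsto (fun t : ℝ => w / t) atTop (nhds 0) := tendsto_id.const_div_atTop w
      have h2 : Tendsto (fun t : ℝ => w / t ^ 2) atTop (nhds 0) :=
        (tendsto_pow_atTop two_ne_zero).const_div_atTop w
      have h3 : Tendsto (fun t : ℝ => exp (-(w / t) ^ 2 / 4)) atTop (nhds 1) := by
        have := (((h1.pow 2).neg.div_const 4).rexp)
        simpa using this
      have h4 := ((((h2.const_add 1).pow p).mul_const (w ^ b)).mul_const (exp (-w / 2))).mul h3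
      simpa using h4
  rw [integral_pow_mul_exp_neg_half] at h
  refine h.congr' ?_
  filter_upwards [eventually_gt_atTop 0] with t ht
  rw [tailIntegral_eq p b ht, mul_div_cancel_left₀ _ (by positivity)]

lemma integrableOn_seedPDF_mul_real_Ici {a d b : ℕ} (hd : 1 ≤ d) (hb : 1 ≤ b) {t : ℝ}
    (ht : 0 < t) : IntegrableOn (fun x => seedPDF a (t + x) *
      (ProbabilityTheory.betaMeasure d b).real (Set.Ici (1 - x / (t + x)))) (Set.Ioi 0) := by
  have := isProbabilityMeasure_betaMeasure hd hb
  have hm : Measurable fun s => (ProbabilityTheory.betaMeasure d b).real (Set.Ici s) :=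
    Antitone.measurable fun s s' h => measureReal_mono (Set.Ici_subset_Ici.2 h)
  have hm' : Measurable fun x : ℝ => 1 - x / (t + x) := by fun_prop
  refine ((integrableOn_tailIntegral (2 * a) 0 ht.le).const_mul
    (1 / (2 ^ (2 * a) * Gamma ((a : ℝ) + 1 / 2)))).mono'
    (((measurable_seedPDF a).comp (measurable_const_add t)).mul
      (hm.comp hm')).aestronglyMeasurable
    (ae_of_all _ fun x => ?_)
  have h0 := seedPDF_nonneg a (t + x)
  rw [norm_of_nonneg (by positivity)]
  refine (mul_le_of_le_one_right h0 measureReal_le_one).trans (le_of_eq ?_)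
  rw [seedPDF, pow_zero, mul_one]

open ProbabilityTheory in
lemma degreeLaw_real_Ici_le {a d b : ℕ} (hd : 1 ≤ d) (hb : 1 ≤ b) (hdb : d + b = 2 * a)
    {t : ℝ} (ht : 0 < t) : (degreeLaw a d b).real (Set.Ici t) ≤
      1 / (2 ^ (2 * a) * Gamma ((a : ℝ) + 1 / 2)) * (1 / (b * beta d b)) *
        tailIntegral d b t := by
  have hb0 : 0 < beta d b := beta_pos (by exact_mod_cast hd) (by exact_mod_cast hb)
  have hb1 : (0 : ℝ) < b := by exact_mod_cast hb
  have hG : 0 < Gamma ((a : ℝ) + 1 / 2) := Gamma_pos_of_pos (by positivity)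
  rw [degreeLaw_real_Ici hd hb ht, tailIntegral, ← integral_const_mul]
  refine setIntegral_mono_on (integrableOn_seedPDF_mul_real_Ici hd hb ht)
    ((integrableOn_tailIntegral d b ht.le).const_mul _) measurableSet_Ioi fun x hx => ?_
  have hx : 0 < x := hx
  have hv := betaMeasure_real_Ici_le hd hb (v := x / (t + x)) (by positivity)
    (by rw [div_lt_one (by positivity)]; linarith)
  refine (mul_le_mul_of_nonneg_left hv (seedPDF_nonneg a _)).trans (le_of_eq ?_)
  rw [seedPDF, ← hdb, pow_add _ d b, pow_add _ d b, div_pow]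
  have hu : 0 < t + x := by positivity
  field_simp

open ProbabilityTheory in
lemma le_degreeLaw_real_Ici {a d b : ℕ} (hd : 1 ≤ d) (hb : 1 ≤ b) (hdb : d + b = 2 * a)
    {t : ℝ} (ht : 0 < t) : 1 / (2 ^ (2 * a) * Gamma ((a : ℝ) + 1 / 2)) *
      (1 / (b * beta d b)) * t ^ (d - 1) * tailIntegral 1 b t ≤
        (degreeLaw a d b).real (Set.Ici t) := by
  have hb0 : 0 < beta d b := beta_pos (by exact_mod_cast hd) (by exact_mod_cast hb)
  have hb1 : (0 : ℝ) < b := by exact_mod_cast hb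
  have hG : 0 < Gamma ((a : ℝ) + 1 / 2) := Gamma_pos_of_pos (by positivity)
  rw [degreeLaw_real_Ici hd hb ht, tailIntegral, ← integral_const_mul]
  refine setIntegral_mono_on ((integrableOn_tailIntegral 1 b ht.le).const_mul _)
    (integrableOn_seedPDF_mul_real_Ici hd hb ht) measurableSet_Ioi fun x hx => ?_
  have hx : 0 < x := hx
  have hv := le_betaMeasure_real_Ici hd hb (v := x / (t + x)) (by positivity)
    (by rw [div_lt_one (by positivity)]; linarith)
  refine le_trans (le_of_eq ?_) (mul_le_mul_of_nonneg_left hv (seedPDF_nonneg a _))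
  rw [one_sub_div (by positivity), add_sub_cancel_right, seedPDF, ← hdb]
  obtain ⟨j, rfl⟩ : ∃ j, d = j + 1 := ⟨d - 1, by omega⟩
  rw [Nat.add_sub_cancel, div_pow, div_pow, pow_add _ _ b, pow_add _ _ b, pow_succ _ j,
    pow_succ _ j]
  have hu : 0 < t + x := by positivity
  field_simp

/-- The order of magnitude of the tail of the degree law. -/
def tailRate (a d : ℕ) (t : ℝ) : ℝ := t ^ (2 * d) / t ^ (2 * a + 1) * exp (-t ^ 2 / 4)

lemma tailRate_pos (a d : ℕ) {t : ℝ} (ht : 0 < t) : 0 < tailRate a d t := by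
  unfold tailRate
  positivity

lemma tailRate_eq {a d b : ℕ} (hdb : d + b = 2 * a) {t : ℝ} (ht : 0 < t) :
    t ^ d / t ^ (b + 1) * exp (-t ^ 2 / 4) = tailRate a d t := by
  rw [tailRate, ← hdb]
  field_simp
  ring

lemma tendsto_tailRate_div (a : ℕ) {d d' : ℕ} (h : d < d') :
    Tendsto (fun t => tailRate a d t / tailRate a d' t) atTop (nhds 0) := by
  have h1 : Tendsto (fun t : ℝ => 1 / t ^ (2 * (d' - d))) atTop (nhds 0) :=
    (tendsto_pow_atTop (by omega)).const_div_atTop 1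
  refine h1.congr' ?_
  filter_upwards [eventually_gt_atTop 0] with t ht
  obtain ⟨j, rfl⟩ : ∃ j, d' = d + j := ⟨d' - d, by omega⟩
  rw [tailRate, tailRate, Nat.add_sub_cancel_left]
  field_simp
  ring

open ProbabilityTheory in
lemma tendsto_degreeLaw_div {a d b : ℕ} (hd : 1 ≤ d) (hb : 1 ≤ b) (hdb : d + b = 2 * a) :
    Tendsto (fun t => (degreeLaw a d b).real (Set.Ici t) / tailRate a d t) atTop
      (nhds (cconst ((a : ℝ) + 1) d)) := by
  have hb0 : 0 < beta d b := beta_pos (by exact_mod_cast hd) (by exact_mod_cast hb)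
  have hb1 : (0 : ℝ) < b := by exact_mod_cast hb
  have hG : 0 < Gamma ((a : ℝ) + 1 / 2) := Gamma_pos_of_pos (by positivity)
  set K : ℝ := 1 / (2 ^ (2 * a) * Gamma ((a : ℝ) + 1 / 2)) * (1 / (b * beta d b)) with hK
  have hc : K * (2 ^ (b + 1) * b.factorial) = cconst ((a : ℝ) + 1) d := by
    have g1 : 0 < Gamma (d : ℝ) := Gamma_pos_of_pos (by exact_mod_cast hd)
    have g2 : 0 < Gamma (b : ℝ) := Gamma_pos_of_pos hb1
    have hf : (b.factorial : ℝ) = b * Gamma b := by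
      rw [← Gamma_add_one hb1.ne', Gamma_nat_eq_factorial]
    obtain ⟨j, rfl⟩ : ∃ j, d = j + 1 := ⟨d - 1, by omega⟩
    rw [hK, cconst, beta, hf, show 2 * ((a : ℝ) + 1) - 2 = ((j + 1 : ℕ) : ℝ) + b by
        rw [← Nat.cast_add, hdb]; push_cast; ring,
      show (a : ℝ) + 1 - 1 / 2 = a + 1 / 2 by ring,
      show ((j + 1 : ℕ) : ℝ) - 1 = (j : ℝ) by push_cast; ring, rpow_natCast, ← hdb]
    have g3 : 0 < Gamma (((j + 1 : ℕ) : ℝ) + b) := Gamma_pos_of_pos (by positivity)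
    field_simp
    ring
  rw [← hc]
  refine tendsto_of_tendsto_of_tendsto_of_le_of_le'
    ((tendsto_tailIntegral 1 b).const_mul K) ((tendsto_tailIntegral d b).const_mul K) ?_ ?_
  · filter_upwards [eventually_gt_atTop 0] with t ht
    rw [← tailRate_eq hdb ht, le_div_iff₀ (by positivity)]
    refine le_trans (le_of_eq ?_) (le_degreeLaw_real_Ici hd hb hdb ht)
    rw [← hK]
    obtain ⟨j, rfl⟩ : ∃ j, d = j + 1 := ⟨d - 1, by omega⟩
    rw [Nat.add_sub_cancel]
    field_simp
    ring
  · filter_upwards [eventually_gt_atTop 0] with t ht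
    rw [tailRate_eq hdb ht, ← mul_div_assoc]
    have := tailRate_pos a d ht
    gcongr
    exact degreeLaw_real_Ici_le hd hb hdb ht

lemma seedLaw_real_Ici (a : ℕ) {t : ℝ} (ht : 0 < t) : (seedLaw a).real (Set.Ici t) =
    1 / (2 ^ (2 * a) * Gamma ((a : ℝ) + 1 / 2)) * tailIntegral (2 * a) 0 t := by
  have h2 := (measurePreserving_add_left volume t).setIntegral_preimage_emb
    (measurableEmbedding_addLeft t) (seedPDF a) (Set.Ioi t)
  rw [show (fun x => t + x) ⁻¹' Set.Ioi t = Set.Ioi 0 by ext; simp] at h2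
  rw [← integral_indicator_one measurableSet_Ici, integral_seedLaw, tailIntegral,
    ← integral_const_mul]
  simp_rw [pow_zero, mul_one]
  refine Eq.trans ?_ h2.symm
  rw [← integral_Ici_eq_integral_Ioi (x := t), ← integral_indicator measurableSet_Ici,
    ← integral_indicator measurableSet_Ioi]
  congr 1
  ext y
  simp only [Set.indicator_apply, Set.mem_Ioi, Set.mem_Ici, Pi.one_apply]
  by_cases h : t ≤ y
  · simp [h, ht.trans_le h]
  · simp [h]

lemma tendsto_seedLaw_two_mul_div (a d : ℕ) :
    Tendsto (fun t => (seedLaw a).real (Set.Ici (2 * t)) / tailRate a d t) atTop (nhds 0) := by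
  have hG : 0 < Gamma ((a : ℝ) + 1 / 2) := Gamma_pos_of_pos (by positivity)
  have h1 := ((tendsto_tailIntegral (2 * a) 0).comp
    (tendsto_id.const_mul_atTop (two_pos : (0 : ℝ) < 2))).const_mul
      (1 / (2 ^ (2 * a) * Gamma ((a : ℝ) + 1 / 2)) * 2 ^ (2 * a))
  have h2 := h1.mul (tendsto_pow_mul_exp_neg_atTop_nhds_zero (4 * a))
  rw [mul_zero] at h2
  refine squeeze_zero' ?_ ?_ h2
  · filter_upwards [eventually_gt_atTop 0] with t ht
    have := tailRate_pos a d ht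
    positivity
  · filter_upwards [eventually_ge_atTop 2] with t ht
    have ht0 : 0 < t := by linarith
    have ht1 : 1 ≤ t := by linarith
    have hI := tailIntegral_nonneg (2 * a) 0 (t := 2 * t) (by linarith)
    rw [seedLaw_real_Ici a (by positivity), div_le_iff₀ (tailRate_pos a d ht0)]
    simp only [Function.comp_apply, id_eq]
    set I := tailIntegral (2 * a) 0 (2 * t)
    have key : (2 * t) ^ (2 * a) / (2 * t) ^ (0 + 1) * exp (-(2 * t) ^ 2 / 4) ≤
        2 ^ (2 * a) * (t ^ (4 * a) * exp (-t)) * tailRate a d t := by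
      have e1 : exp (-(2 * t) ^ 2 / 4) ≤ exp (-t) * exp (-t ^ 2 / 4) := by
        rw [← exp_add]
        refine exp_le_exp.2 ?_
        nlinarith
      calc _ ≤ (2 * t) ^ (2 * a) / (2 * t) ^ (0 + 1) * (exp (-t) * exp (-t ^ 2 / 4)) := by
            gcongr
        _ ≤ (2 * t) ^ (2 * a) / t * (exp (-t) * exp (-t ^ 2 / 4)) := by
            gcongr
            rw [zero_add, pow_one]
            linarith
        _ = 2 ^ (2 * a) * (t ^ (4 * a) * exp (-t)) * (1 / t ^ (2 * a + 1) * exp (-t ^ 2 / 4)) := by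
            rw [mul_pow]
            field_simp
            ring
        _ ≤ _ := by
            unfold tailRate
            gcongr
            exact one_le_pow₀ ht1
    have hpos : 0 < (2 * t) ^ (2 * a) / (2 * t) ^ (0 + 1) * exp (-(2 * t) ^ 2 / 4) := by
      positivity
    set R := (2 * t) ^ (2 * a) / (2 * t) ^ (0 + 1) * exp (-(2 * t) ^ 2 / 4)
    calc 1 / (2 ^ (2 * a) * Gamma ((a : ℝ) + 1 / 2)) * I =
          1 / (2 ^ (2 * a) * Gamma ((a : ℝ) + 1 / 2)) * (I / R) * R := by field_simp
      _ ≤ 1 / (2 ^ (2 * a) * Gamma ((a : ℝ) + 1 / 2)) * (I / R) *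
          (2 ^ (2 * a) * (t ^ (4 * a) * exp (-t)) * tailRate a d t) := by gcongr
      _ = _ := by ring

lemma factorial_mul_Gamma_le {k : ℕ} (hk : 1 ≤ k) (j : ℕ) :
    j.factorial * Gamma ((k : ℝ) + 1 / 2) ≤ Gamma (((k + j : ℕ) : ℝ) + 1 / 2) := by
  induction j with
  | zero => simp
  | succ j ih =>
    have hk' : (1 : ℝ) ≤ k := by exact_mod_cast hk
    rw [show ((k + (j + 1) : ℕ) : ℝ) + 1 / 2 = ((k + j : ℕ) : ℝ) + 1 / 2 + 1 by push_cast; ring,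
      Gamma_add_one (by positivity), Nat.factorial_succ, Nat.cast_mul, mul_assoc]
    have hG : 0 < Gamma ((k : ℝ) + 1 / 2) := Gamma_pos_of_pos (by positivity)
    gcongr
    push_cast
    linarith

open ProbabilityTheory in
lemma mul_beta_one {b : ℕ} (hb : 1 ≤ b) : (b : ℝ) * beta (1 : ℕ) b = 1 := by
  have hb1 : (0 : ℝ) < b := by exact_mod_cast hb
  have := Gamma_pos_of_pos hb1
  rw [beta, Nat.cast_one, Gamma_one, add_comm, Gamma_add_one hb1.ne']
  field_simp

/-- The degree laws of the vertices outside the seed have negligible tails. -/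
lemma exists_sum_degreeLaw_le {k : ℕ} (hk : 1 ≤ k) : ∃ C : ℝ, ∀ t : ℝ, 1 ≤ t → ∀ N : ℕ,
    ∑ j ∈ Finset.range N, (degreeLaw (k + j) 1 (2 * (k + j) - 1)).real (Set.Ici t) ≤
      C * tailRate (k - 1) 0 t := by
  have hG : 0 < Gamma ((k : ℝ) + 1 / 2) := Gamma_pos_of_pos (by positivity)
  set K : ℝ := 1 / (2 ^ (2 * k) * Gamma ((k : ℝ) + 1 / 2)) with hK
  have hK0 : 0 ≤ K := by positivity
  refine ⟨K * ∫ w in Set.Ioi 0, (1 + w) ^ 1 * w ^ (2 * k - 1) * exp (-w / 2), fun t ht N => ?_⟩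
  have ht0 : 0 < t := by linarith
  set g : ℝ → ℝ := fun x => K * ((t + x) * x ^ (2 * k - 1) * exp (x ^ 2 / 4) *
    exp (-(t + x) ^ 2 / 4))
  set F : ℕ → ℝ → ℝ := fun j x => K / (4 ^ j * j.factorial) *
    ((t + x) ^ 1 * x ^ (2 * (k + j) - 1) * exp (-(t + x) ^ 2 / 4))
  have hF : ∀ j, (degreeLaw (k + j) 1 (2 * (k + j) - 1)).real (Set.Ici t) ≤
      ∫ x in Set.Ioi 0, F j x := by
    intro j
    have h := degreeLaw_real_Ici_le (a := k + j) (d := 1) (b := 2 * (k + j) - 1) le_rfl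
      (by omega) (by omega) ht0
    rw [mul_beta_one (by omega), div_one, mul_one] at h
    refine h.trans ?_
    simp only [F]
    rw [integral_const_mul]
    refine mul_le_mul_of_nonneg_right ?_ (tailIntegral_nonneg _ _ ht0.le)
    have h1 := factorial_mul_Gamma_le hk j
    rw [hK, div_div, mul_add, pow_add, pow_mul 2 2 j, show (2 : ℝ) ^ 2 = 4 by norm_num]
    refine one_div_le_one_div_of_le (by positivity) ?_
    calc _ = 2 ^ (2 * k) * 4 ^ j * (j.factorial * Gamma ((k : ℝ) + 1 / 2)) := by ring
      _ ≤ _ := by gcongr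
  have hFi : ∀ j, IntegrableOn (F j) (Set.Ioi 0) := fun j =>
    (integrableOn_tailIntegral 1 _ ht0.le).const_mul _
  have hsum : ∀ x ∈ Set.Ioi (0 : ℝ), ∑ j ∈ Finset.range N, F j x ≤ g x := by
    intro x hx
    have hx : 0 < x := hx
    have h := Real.sum_le_exp_of_nonneg (x := x ^ 2 / 4) (by positivity) N
    calc _ = K * ((t + x) * x ^ (2 * k - 1) *
          (∑ j ∈ Finset.range N, (x ^ 2 / 4) ^ j / j.factorial) * exp (-(t + x) ^ 2 / 4)) := by
          rw [Finset.mul_sum, Finset.sum_mul, Finset.mul_sum]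
          refine Finset.sum_congr rfl fun j _ => ?_
          simp only [F]
          rw [show 2 * (k + j) - 1 = 2 * k - 1 + 2 * j by omega, pow_add, div_pow, pow_mul x 2 j]
          field_simp
      _ ≤ _ := by
          simp only [g]
          gcongr
  calc _ ≤ ∑ j ∈ Finset.range N, ∫ x in Set.Ioi 0, F j x := Finset.sum_le_sum fun j _ => hF j
    _ = ∫ x in Set.Ioi 0, ∑ j ∈ Finset.range N, F j x :=
        (integral_finsetSum _ fun j _ => hFi j).symm
    _ = t⁻¹ * ∫ w in Set.Ioi 0, ∑ j ∈ Finset.range N, F j (w / t) :=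
        setIntegral_Ioi_eq_comp_div _ ht0
    _ ≤ t⁻¹ * ∫ w in Set.Ioi 0, K * (t / t ^ (2 * k - 1) * exp (-t ^ 2 / 4)) *
          ((1 + w) ^ 1 * w ^ (2 * k - 1) * exp (-w / 2)) := by
        refine mul_le_mul_of_nonneg_left (integral_mono_of_nonneg ?_
          ((integrableOn_one_add_pow_mul_exp 1 (2 * k - 1)).const_mul _) ?_) (by positivity)
        · refine (ae_restrict_mem measurableSet_Ioi).mono fun w hw => ?_
          have hw : 0 < w := hw
          simp only [F, Pi.zero_apply]
          positivity
        · refine (ae_restrict_mem measurableSet_Ioi).mono fun w hw => ?_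
          have hw : 0 < w := hw
          refine (hsum (w / t) (show 0 < w / t by positivity)).trans ?_
          have e1 : exp ((w / t) ^ 2 / 4) * exp (-(t + w / t) ^ 2 / 4) =
              exp (-t ^ 2 / 4) * exp (-w / 2) := by
            rw [← exp_add, ← exp_add]
            congr 1
            field_simp
            ring
          have e2 : t + w / t ≤ t * (1 + w) := by
            have : w / t ≤ t * w := by
              rw [div_le_iff₀ ht0]
              nlinarith [mul_le_mul ht ht zero_le_one ht0.le]
            linarith
          simp only [g]
          calc _ = K * ((t + w / t) * (w ^ (2 * k - 1) / t ^ (2 * k - 1)) *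
                (exp (-t ^ 2 / 4) * exp (-w / 2))) := by rw [← e1, div_pow]; ring
            _ ≤ K * (t * (1 + w) * (w ^ (2 * k - 1) / t ^ (2 * k - 1)) *
                (exp (-t ^ 2 / 4) * exp (-w / 2))) := by gcongr
            _ = _ := by ring
    _ = _ := by
        rw [integral_const_mul, tailRate, show 2 * (k - 1) + 1 = 2 * k - 1 by omega,
          mul_zero, pow_zero]
        field_simp

section limits

variable {k : ℕ} {T : SimpleGraph ℕ}

/-- Convergence of the tails of rescaled degree sums, by the method of moments. -/
lemma tendsto_real_degSum_ge (hk : 2 ≤ k) (hT : IsTreeOn k T) {n₀ d : ℕ} (hn₀ : k ≤ n₀)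
    {A : Finset ℕ} (hA : A ⊆ Finset.range n₀) (hd : ∀ᵐ G ∂PAlaw k T n₀, degSum A G = d)
    {μ : Measure ℝ} [IsProbabilityMeasure μ] (h0 : ∀ᵐ x ∂μ, 0 ≤ x)
    (hexp : ∀ t, Integrable (fun x => exp (t * x)) μ)
    (hmom : ∀ r, ∫ x, x ^ r ∂μ = limMoment n₀ d r) {t : ℝ} (ht : μ {t} = 0) :
    Tendsto (fun n : ℕ => (PAlaw k T n).real {G | t * √n ≤ degSum A G}) atTop
      (nhds (μ.real (Set.Ici t))) := by
  have hprob : ∀ n, IsProbabilityMeasure (PAlaw k T (n + k)) := fun n =>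
    isProbabilityMeasure_PAlaw hk hT (by omega)
  let Y : ℕ → SimpleGraph ℕ → ℝ := fun n G => (degSum A G : ℝ) / √(n + k : ℕ)
  have hY : ∀ n, Measurable (Y n) := fun n => measurable_from_top
  have hprob' : ∀ n, IsProbabilityMeasure ((PAlaw k T (n + k)).map (Y n)) := fun n =>
    Measure.isProbabilityMeasure_map (hY n).aemeasurable
  have key := tendsto_real_Ici_of_tendsto_moments
    (ν := fun n => (PAlaw k T (n + k)).map (Y n)) (μ := μ) ?_ ?_ h0 hexp ?_ ht
  · rw [← tendsto_add_atTop_iff_nat k]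
    refine key.congr fun n => ?_
    rw [map_measureReal_apply (hY n) measurableSet_Ici]
    congr 1
    ext G
    have : 0 < √((n + k : ℕ) : ℝ) := sqrt_pos.2 (by exact_mod_cast (by omega : 0 < n + k))
    simp only [Y, Set.mem_preimage, Set.mem_Ici, Set.mem_ofPred_eq]
    rw [le_div_iff₀ this]
  · intro n
    rw [ae_map_iff (hY n).aemeasurable measurableSet_Ici]
    exact ae_of_all _ fun G => by positivity
  · intro n r
    rw [integrable_map_measure (by fun_prop) (hY n).aemeasurable]
    exact integrable_comp_degSum hk hT (by omega) A fun m => ((m : ℝ) / √(n + k : ℕ)) ^ r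
  · intro r
    rw [hmom]
    refine ((tendsto_add_atTop_iff_nat k).2
      (tendsto_integral_pow hk hT hn₀ hA hd r)).congr fun n => ?_
    rw [integral_map (hY n).aemeasurable (by fun_prop)]

lemma tendsto_real_degN_ge (hk : 2 ≤ k) (hT : IsTreeOn k T) {n₀ d b i : ℕ} (hn₀ : k ≤ n₀)
    (hi : i < n₀) (hd : ∀ᵐ G ∂PAlaw k T n₀, degN G i = d) (hd1 : 1 ≤ d) (hb : 1 ≤ b)
    (hdb : d + b = 2 * (n₀ - 1)) (t : ℝ) :
    Tendsto (fun n : ℕ => (PAlaw k T n).real {G | t * √n ≤ degN G i}) atTop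
      (nhds ((degreeLaw (n₀ - 1) d b).real (Set.Ici t))) := by
  have := isProbabilityMeasure_degreeLaw (a := n₀ - 1) hd1 hb
  have h := tendsto_real_degSum_ge hk hT hn₀ (A := {i}) (d := d) (by simpa using hi)
    (by simpa [degSum] using hd) (ae_degreeLaw_nonneg hd1 hb) (integrable_exp_degreeLaw hd1 hb)
    (integral_degreeLaw_pow (hk.trans hn₀) hd1 hb hdb) (degreeLaw_singleton hd1 hb t)
  simpa [degSum] using h

lemma tendsto_real_degN_seed_ge (hk : 2 ≤ k) (hT : IsTreeOn k T) {i : ℕ} (hi : i < k) (t : ℝ) :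
    Tendsto (fun n : ℕ => (PAlaw k T n).real {G | t * √n ≤ degN G i}) atTop
      (nhds ((degreeLaw (k - 1) (degN T i) (2 * (k - 1) - degN T i)).real (Set.Ici t))) := by
  have h1 := IsTreeOn.degN_pos hk hT hi
  have h2 := IsTreeOn.degN_lt hT hi
  refine tendsto_real_degN_ge hk hT le_rfl hi ?_ h1 (by omega) (by omega) t
  rw [PAlaw_self, ae_dirac_eq]
  rfl

lemma tendsto_real_degN_new_ge (hk : 2 ≤ k) (hT : IsTreeOn k T) {i : ℕ} (hi : k ≤ i) (t : ℝ) :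
    Tendsto (fun n : ℕ => (PAlaw k T n).real {G | t * √n ≤ degN G i}) atTop
      (nhds ((degreeLaw i 1 (2 * i - 1)).real (Set.Ici t))) :=
  tendsto_real_degN_ge hk hT (n₀ := i + 1) (by omega) (by omega) (ae_degN_eq_one hT hi) le_rfl
    (by omega) (by omega) t

lemma tendsto_real_degSum_seed_ge (hk : 2 ≤ k) (hT : IsTreeOn k T) (t : ℝ) :
    Tendsto (fun n : ℕ => (PAlaw k T n).real {G | t * √n ≤ degSum (Finset.range k) G}) atTop
      (nhds ((seedLaw (k - 1)).real (Set.Ici t))) := by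
  refine tendsto_real_degSum_ge hk hT le_rfl (d := 2 * (k - 1)) subset_rfl ?_
    ((ae_seedLaw_pos _).mono fun _ => le_of_lt) (integrable_exp_seedLaw _)
    (integral_seedLaw_pow_eq_limMoment hk) (measure_singleton t)
  rw [PAlaw_self, ae_dirac_eq]
  exact hT.isPAGraph.2

end limits

section bounds

variable {k : ℕ} {T : SimpleGraph ℕ}

lemma tendsto_sum_real_degN_new_ge (hk : 2 ≤ k) (hT : IsTreeOn k T) {t : ℝ} (ht : 0 < t) :
    Tendsto (fun n : ℕ => ∑ j ∈ Finset.range (n - k),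
      (PAlaw k T n).real {G | t * √n ≤ degN G (k + j)}) atTop
      (nhds (∑' j, (degreeLaw (k + j) 1 (2 * (k + j) - 1)).real (Set.Ici t))) := by
  have hs : Summable fun j : ℕ => 24 / t ^ 4 * (1 / (((j : ℝ) + 1) ^ 2)) := by
    refine Summable.mul_left _ ?_
    have := (summable_nat_add_iff 1).2 (Real.summable_one_div_nat_pow.2 one_lt_two)
    simpa using this
  have h := tendsto_tsum_of_dominated_convergence (𝓕 := atTop)
    (f := fun n j => if j < n - k then (PAlaw k T n).real {G | t * √n ≤ degN G (k + j)} else 0)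
    (g := fun j => (degreeLaw (k + j) 1 (2 * (k + j) - 1)).real (Set.Ici t)) hs ?_ ?_
  · refine h.congr fun n => ?_
    rw [tsum_eq_sum (s := Finset.range (n - k)) fun j hj => if_neg (by simpa using hj)]
    exact Finset.sum_congr rfl fun j hj => if_pos (Finset.mem_range.1 hj)
  · intro j
    refine (tendsto_real_degN_new_ge hk hT (Nat.le_add_right k j) t).congr' ?_
    filter_upwards [eventually_gt_atTop (k + j)] with n hn
    rw [if_pos (by omega)]
  · refine Eventually.of_forall fun n j => ?_
    split_ifs with hj
    · rw [norm_of_nonneg measureReal_nonneg]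
      refine (measure_degN_ge_le hk hT (Nat.le_add_right k j) (by omega) ht).trans ?_
      have hk' : (1 : ℝ) ≤ k := by exact_mod_cast (by omega : 1 ≤ k)
      have hj' : (0 : ℝ) ≤ j := j.cast_nonneg
      push_cast
      gcongr
      nlinarith
    · rw [norm_zero]
      positivity

lemma real_maxDeg_ge_le {n : ℕ} (hk : 2 ≤ k) (hT : IsTreeOn k T) (hn : k ≤ n) {x : ℝ}
    (hx : 0 < x) : (PAlaw k T n).real {G | x ≤ maxDeg G} ≤
      ∑ i ∈ Finset.range k, (PAlaw k T n).real {G | x ≤ degN G i} +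
        ∑ j ∈ Finset.range (n - k), (PAlaw k T n).real {G | x ≤ degN G (k + j)} := by
  have := isProbabilityMeasure_PAlaw hk hT hn
  rw [← Finset.sum_Ico_eq_sum_range (fun i => (PAlaw k T n).real {G | x ≤ degN G i}),
    Finset.sum_range_add_sum_Ico _ hn]
  refine le_trans ?_ (measureReal_biUnion_finset_le _ _)
  refine ENNReal.toReal_mono (measure_ne_top _ _) (measure_mono_ae ?_)
  filter_upwards [ae_isPAGraph hT hn] with G hG hGx
  have hGx : x ≤ maxDeg G := hGx
  obtain ⟨v, hv⟩ := exists_degN_eq_maxDeg hG.1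
  have hvn : v < n := by
    by_contra h
    rw [← hv, degN_eq_zero hG.1 (not_lt.1 h), Nat.cast_zero] at hGx
    linarith
  refine Set.mem_biUnion (x := v) (by simpa using hvn) ?_
  show x ≤ degN G v
  rwa [hv]

lemma sum_real_degN_ge_le {n : ℕ} (hk : 2 ≤ k) (hT : IsTreeOn k T) (hn : k ≤ n) (x : ℝ)
    {I : Finset ℕ} (hI : I ⊆ Finset.range k) :
    ∑ i ∈ I, (PAlaw k T n).real {G | x ≤ degN G i} ≤
      (PAlaw k T n).real {G | x ≤ maxDeg G} +
        I.card * (PAlaw k T n).real {G | 2 * x ≤ degSum (Finset.range k) G} := by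
  classical
  have := isProbabilityMeasure_PAlaw hk hT hn
  have hm : ∀ s : Set (SimpleGraph ℕ), MeasurableSet s := fun _ => trivial
  have hi : ∀ s : Set (SimpleGraph ℕ), Integrable (s.indicator (1 : SimpleGraph ℕ → ℝ))
      (PAlaw k T n) := fun s => (integrable_const 1).indicator (hm s)
  simp_rw [← integral_indicator_one (hm _)]
  rw [← integral_finsetSum _ fun i _ => hi _, ← integral_const_mul,
    ← integral_add (hi _) ((hi _).const_mul _)]
  refine integral_mono_ae (integrable_finsetSum _ fun i _ => hi _)
    ((hi _).add ((hi _).const_mul _)) ?_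
  filter_upwards [ae_isPAGraph hT hn] with G hG
  simp only [Set.indicator_apply, Set.mem_ofPred_eq, Pi.one_apply]
  rw [Finset.sum_boole]
  by_cases h1 : (I.filter fun i => x ≤ degN G i).card ≤ 1
  · have h3 : (0 : ℝ) ≤ I.card * if 2 * x ≤ degSum (Finset.range k) G then 1 else 0 := by
      positivity
    rcases Finset.eq_empty_or_nonempty (I.filter fun i => x ≤ degN G i) with h2 | ⟨i, hi⟩
    · rw [h2, Finset.card_empty, Nat.cast_zero]
      positivity
    · have h4 : x ≤ maxDeg G := (Finset.mem_filter.1 hi).2.trans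
        (by exact_mod_cast degN_le_maxDeg hG.1 i)
      have h5 : ((I.filter fun i => x ≤ degN G i).card : ℝ) ≤ 1 := by exact_mod_cast h1
      rw [if_pos h4]
      linarith
  · obtain ⟨i, hi, j, hj, hij⟩ := Finset.one_lt_card.1 (not_le.1 h1)
    rw [Finset.mem_filter] at hi hj
    have h2 : degN G i + degN G j ≤ degSum (Finset.range k) G := by
      rw [← Finset.sum_pair hij]
      refine Finset.sum_le_sum_of_subset fun v hv => ?_
      rcases Finset.mem_insert.1 hv with rfl | hv
      · exact hI hi.1
      · rw [Finset.mem_singleton.1 hv]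
        exact hI hj.1
    have h3 : ((degN G i : ℝ) + degN G j) ≤ degSum (Finset.range k) G := by exact_mod_cast h2
    have h6 : 2 * x ≤ (degSum (Finset.range k) G : ℝ) := by linarith [hi.2, hj.2]
    rw [if_pos h6, mul_one]
    have h4 : ((I.filter fun i => x ≤ degN G i).card : ℝ) ≤ I.card := by
      exact_mod_cast Finset.card_filter_le _ _
    have h5 : (0 : ℝ) ≤ if x ≤ maxDeg G then 1 else 0 := by positivity
    linarith

end bounds

lemma measureReal_le_of_ae_eventually_mem {Ω : Type*} [MeasurableSpace Ω] {P : Measure Ω}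
    [IsFiniteMeasure P] {S : Set Ω} {B : ℕ → Set Ω}
    (h : ∀ᵐ ω ∂P, ω ∈ S → ∀ᶠ n in atTop, ω ∈ B n) {u : ℕ → ℝ} {U : ℝ}
    (hu : ∀ᶠ n in atTop, P.real (B n) ≤ u n) (hU : Tendsto u atTop (nhds U)) :
    P.real S ≤ U := by
  have h1 : P.real S ≤ P.real (⋃ N, ⋂ n ≥ N, B n) := by
    refine ENNReal.toReal_mono (measure_ne_top _ _) (measure_mono_ae ?_)
    filter_upwards [h] with ω hω hS
    obtain ⟨N, hN⟩ := eventually_atTop.1 (hω hS)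
    exact Set.mem_iUnion.2 ⟨N, Set.mem_iInter₂.2 hN⟩
  have h2 : Monotone fun N => ⋂ n ≥ N, B n := fun N N' hN =>
    Set.biInter_subset_biInter_left fun n hn => le_trans hN hn
  have h3 := (ENNReal.tendsto_toReal (measure_ne_top P _)).comp (tendsto_measure_iUnion_atTop h2)
  refine h1.trans (le_of_tendsto' h3 fun N => ?_)
  refine ge_of_tendsto hU ?_
  filter_upwards [hu, eventually_ge_atTop N] with n hn hN
  exact (measureReal_mono (Set.iInter₂_subset n hN)).trans hn

lemma tendsto_measureReal_Ici_add {μ : Measure ℝ} [IsFiniteMeasure μ] {t : ℝ} (ht : μ {t} = 0) :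
    Tendsto (fun n : ℕ => μ.real (Set.Ici (t + 1 / ((n : ℝ) + 1)))) atTop
      (nhds (μ.real (Set.Ici t))) := by
  have h1 : μ (Set.Ici t) = μ (⋃ n : ℕ, Set.Ici (t + 1 / ((n : ℝ) + 1))) := by
    have h2 : μ (Set.Ici t) = μ (Set.Ioi t) := by
      refine le_antisymm ?_ (measure_mono Set.Ioi_subset_Ici_self)
      rw [← Set.Ioi_insert, ← Set.singleton_union]
      exact (measure_union_le _ _).trans (by rw [ht, zero_add])
    rw [h2]
    congr 1
    ext x
    simp only [Set.mem_Ioi, Set.mem_iUnion, Set.mem_Ici]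
    refine ⟨fun hx => ?_, fun ⟨n, hn⟩ => ?_⟩
    · obtain ⟨n, hn⟩ := exists_nat_one_div_lt (sub_pos.2 hx)
      exact ⟨n, by linarith⟩
    · have : 0 < 1 / ((n : ℝ) + 1) := by positivity
      linarith
  rw [measureReal_def, h1]
  refine (ENNReal.tendsto_toReal (measure_ne_top μ _)).comp (tendsto_measure_iUnion_atTop ?_)
  intro n m hnm
  refine Set.Ici_subset_Ici.2 ?_
  gcongr

section maxDegree

variable {k : ℕ} {T : SimpleGraph ℕ} {Ω : Type*} [MeasurableSpace Ω] {P : Measure Ω}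
  {X : ℕ → Ω → SimpleGraph ℕ} {Dmax : Ω → ℝ}

lemma real_preimage_eq (hk : 2 ≤ k) (hT : IsTreeOn k T)
    (hX : ∀ n : ℕ, k ≤ n → P.map (X n) = PAlaw k T n) {n : ℕ} (hn : k ≤ n)
    (s : Set (SimpleGraph ℕ)) : P.real {ω | X n ω ∈ s} = (PAlaw k T n).real s := by
  have := isProbabilityMeasure_PAlaw hk hT hn
  have hne : P.map (X n) ≠ 0 := by
    rw [hX n hn]
    exact IsProbabilityMeasure.ne_zero _
  have hm : AEMeasurable (X n) P := by
    by_contra h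
    exact hne (Measure.map_of_not_aemeasurable h)
  rw [← hX n hn, measureReal_def, measureReal_def, Measure.map_apply_of_aemeasurable hm trivial]
  rfl

variable [IsProbabilityMeasure P]

lemma measureReal_Dmax_le (hk : 2 ≤ k) (hT : IsTreeOn k T)
    (hX : ∀ n : ℕ, k ≤ n → P.map (X n) = PAlaw k T n)
    (hDmax : ∀ᵐ ω ∂P, Tendsto (fun n : ℕ => (maxDeg (X n ω) : ℝ) / √n) atTop (nhds (Dmax ω)))
    {t : ℝ} (ht : 0 < t) : P.real {ω | t < Dmax ω} ≤
      ∑ i ∈ Finset.range k,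
        (degreeLaw (k - 1) (degN T i) (2 * (k - 1) - degN T i)).real (Set.Ici t) +
      ∑' j, (degreeLaw (k + j) 1 (2 * (k + j) - 1)).real (Set.Ici t) := by
  refine measureReal_le_of_ae_eventually_mem
    (B := fun n => {ω | X n ω ∈ {G | t * √n ≤ maxDeg G}}) ?_ ?_
    ((tendsto_finsetSum _ fun i hi => tendsto_real_degN_seed_ge hk hT (Finset.mem_range.1 hi) t).add
      (tendsto_sum_real_degN_new_ge hk hT ht))
  · filter_upwards [hDmax] with ω hω htω
    filter_upwards [hω.eventually (lt_mem_nhds htω), eventually_gt_atTop 0] with n hn hn0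
    have : 0 < √(n : ℝ) := sqrt_pos.2 (by exact_mod_cast hn0)
    exact ((lt_div_iff₀ this).1 hn).le
  · filter_upwards [eventually_ge_atTop k] with n hn
    have : 0 < √(n : ℝ) := sqrt_pos.2 (by exact_mod_cast (by omega : 0 < n))
    exact (real_preimage_eq hk hT hX hn {G | t * √n ≤ maxDeg G}).trans_le
      (real_maxDeg_ge_le hk hT hn (by positivity))

lemma le_measureReal_Dmax (hk : 2 ≤ k) (hT : IsTreeOn k T)
    (hX : ∀ n : ℕ, k ≤ n → P.map (X n) = PAlaw k T n)
    (hDmax : ∀ᵐ ω ∂P, Tendsto (fun n : ℕ => (maxDeg (X n ω) : ℝ) / √n) atTop (nhds (Dmax ω)))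
    {I : Finset ℕ} (hI : I ⊆ Finset.range k) (t : ℝ) :
    ∑ i ∈ I, (degreeLaw (k - 1) (degN T i) (2 * (k - 1) - degN T i)).real (Set.Ici t) -
      I.card * (seedLaw (k - 1)).real (Set.Ici (2 * t)) ≤ P.real {ω | t < Dmax ω} := by
  have key : ∀ t' > t,
      ∑ i ∈ I, (degreeLaw (k - 1) (degN T i) (2 * (k - 1) - degN T i)).real (Set.Ici t') -
        I.card * (seedLaw (k - 1)).real (Set.Ici (2 * t')) ≤ P.real {ω | t < Dmax ω} := by
    intro t' ht'
    have h1 : P.real {ω | Dmax ω ≤ t} ≤ 1 -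
        (∑ i ∈ I, (degreeLaw (k - 1) (degN T i) (2 * (k - 1) - degN T i)).real (Set.Ici t') -
          I.card * (seedLaw (k - 1)).real (Set.Ici (2 * t'))) := by
      refine measureReal_le_of_ae_eventually_mem
        (B := fun n => {ω | X n ω ∈ {G | t' * √n ≤ maxDeg G}ᶜ}) ?_ ?_
        (((tendsto_finsetSum _ fun i hi =>
          tendsto_real_degN_seed_ge hk hT (Finset.mem_range.1 (hI hi)) t').sub
          ((tendsto_real_degSum_seed_ge hk hT (2 * t')).const_mul _)).const_sub 1)
      · filter_upwards [hDmax] with ω hω htω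
        have htω : Dmax ω ≤ t := htω
        filter_upwards [hω.eventually (gt_mem_nhds (htω.trans_lt ht')), eventually_gt_atTop 0]
          with n hn hn0
        have : 0 < √(n : ℝ) := sqrt_pos.2 (by exact_mod_cast hn0)
        exact not_le.2 ((div_lt_iff₀ this).1 hn)
      · filter_upwards [eventually_ge_atTop k] with n hn
        have := isProbabilityMeasure_PAlaw hk hT hn
        have h := sum_real_degN_ge_le hk hT hn (t' * √n) hI
        refine (real_preimage_eq hk hT hX hn {G | t' * √n ≤ maxDeg G}ᶜ).trans_le ?_
        rw [probReal_compl_eq_one_sub (MeasurableSpace.measurableSet_top)]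
        simp_rw [← mul_assoc] at h
        linarith
    have h2 : (1 : ℝ) ≤ P.real {ω | t < Dmax ω} + P.real {ω | Dmax ω ≤ t} := by
      rw [← probReal_univ (μ := P), show (Set.univ : Set Ω) =
        {ω | t < Dmax ω} ∪ {ω | Dmax ω ≤ t} by ext ω; simp [lt_or_ge]]
      exact measureReal_union_le _ _
    linarith
  have hlim : Tendsto (fun n : ℕ =>
      ∑ i ∈ I, (degreeLaw (k - 1) (degN T i) (2 * (k - 1) - degN T i)).real
        (Set.Ici (t + 1 / ((n : ℝ) + 1))) -
      I.card * (seedLaw (k - 1)).real (Set.Ici (2 * t))) atTop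
      (nhds (∑ i ∈ I, (degreeLaw (k - 1) (degN T i) (2 * (k - 1) - degN T i)).real (Set.Ici t) -
        I.card * (seedLaw (k - 1)).real (Set.Ici (2 * t)))) := by
    refine (tendsto_finsetSum _ fun i hi => ?_).sub_const _
    have h1 := IsTreeOn.degN_pos hk hT (Finset.mem_range.1 (hI hi))
    have h2 := IsTreeOn.degN_lt hT (Finset.mem_range.1 (hI hi))
    have hb : 1 ≤ 2 * (k - 1) - degN T i := by omega
    have := isProbabilityMeasure_degreeLaw (a := k - 1) h1 hb
    exact tendsto_measureReal_Ici_add (degreeLaw_singleton h1 hb t)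
  refine le_of_tendsto' hlim fun n => ?_
  have hn : 0 < 1 / ((n : ℝ) + 1) := by positivity
  refine le_trans ?_ (key (t + 1 / ((n : ℝ) + 1)) (by linarith))
  have h := measureReal_mono (μ := seedLaw (k - 1))
    (Set.Ici_subset_Ici.2 (by linarith : 2 * t ≤ 2 * (t + 1 / ((n : ℝ) + 1))))
  exact sub_le_sub_left (mul_le_mul_of_nonneg_left h I.card.cast_nonneg) _

end maxDegree

lemma cconst_pos {a b : ℝ} (ha : 1 < a) (hb : 0 < b) : 0 < cconst a b := by
  have h1 := Gamma_pos_of_pos (by linarith : 0 < 2 * a - 2)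
  have h2 := Gamma_pos_of_pos (by linarith : 0 < a - 1 / 2)
  have h3 := Gamma_pos_of_pos hb
  rw [cconst]
  positivity

lemma rpow_mul_exp_eq_tailRate {k : ℕ} (hk : 1 ≤ k) (d : ℕ) {t : ℝ} (ht : 0 < t) :
    t ^ ((1 : ℝ) - 2 * k + 2 * (d : ℝ)) * exp (-t ^ 2 / 4) = tailRate (k - 1) d t := by
  rw [tailRate, ← rpow_natCast t (2 * d), ← rpow_natCast t (2 * (k - 1) + 1), ← rpow_sub ht]
  congr 2
  · push_cast [hk]
    ring

section seed

variable {k : ℕ} {T : SimpleGraph ℕ}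

lemma exists_lt_degN_eq_maxDeg (hk : 2 ≤ k) (hT : IsTreeOn k T) :
    ∃ v < k, degN T v = maxDeg T := by
  obtain ⟨v, hv⟩ := exists_degN_eq_maxDeg hT.1
  refine ⟨v, ?_, hv⟩
  by_contra h
  have h0 := IsTreeOn.degN_pos hk hT (v := 0) (by omega)
  have h1 := degN_le_maxDeg hT.1 0
  rw [← hv, degN_eq_zero hT.1 (not_lt.1 h)] at h1
  omega

lemma tendsto_degreeLaw_degN_div (hk : 2 ≤ k) (hT : IsTreeOn k T) {v : ℕ} (hv : v < k) :
    Tendsto (fun t => (degreeLaw (k - 1) (degN T v) (2 * (k - 1) - degN T v)).real (Set.Ici t) /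
      tailRate (k - 1) (maxDeg T) t) atTop
      (nhds (if degN T v = maxDeg T then cconst k (maxDeg T) else 0)) := by
  have h1 := IsTreeOn.degN_pos hk hT hv
  have h2 := IsTreeOn.degN_lt hT hv
  have h := tendsto_degreeLaw_div (a := k - 1) h1
    (by omega : 1 ≤ 2 * (k - 1) - degN T v) (by omega)
  rw [show (((k - 1 : ℕ) : ℝ) + 1) = k by push_cast [show 1 ≤ k by omega]; ring] at h
  split_ifs with hd
  · rwa [← hd]
  · have hlt := lt_of_le_of_ne (degN_le_maxDeg hT.1 v) hd
    have h3 := h.mul (tendsto_tailRate_div (k - 1) hlt)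
    rw [mul_zero] at h3
    refine h3.congr' ?_
    filter_upwards [eventually_gt_atTop 0] with t ht
    exact div_mul_div_cancel₀ (tailRate_pos _ _ ht).ne'

lemma tendsto_measureReal_Dmax_div (hk : 2 ≤ k) (hT : IsTreeOn k T) {Ω : Type*}
    [MeasurableSpace Ω] {P : Measure Ω} [IsProbabilityMeasure P] {X : ℕ → Ω → SimpleGraph ℕ}
    {Dmax : Ω → ℝ} (hX : ∀ n : ℕ, k ≤ n → P.map (X n) = PAlaw k T n)
    (hDmax : ∀ᵐ ω ∂P, Tendsto (fun n : ℕ => (maxDeg (X n ω) : ℝ) / √n) atTop (nhds (Dmax ω))) :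
    Tendsto (fun t => P.real {ω | t < Dmax ω} / tailRate (k - 1) (maxDeg T) t) atTop
      (nhds (((Finset.range k).filter fun i => degN T i = maxDeg T).card *
        cconst k (maxDeg T))) := by
  set I := (Finset.range k).filter fun i => degN T i = maxDeg T with hI
  have hIk : I ⊆ Finset.range k := Finset.filter_subset _ _
  have hΔ : 0 < maxDeg T := by
    obtain ⟨v, hv, h⟩ := exists_lt_degN_eq_maxDeg hk hT
    exact h ▸ IsTreeOn.degN_pos hk hT hv
  obtain ⟨C, hC⟩ := exists_sum_degreeLaw_le (k := k) (by omega)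
  have hlow : Tendsto (fun t => ∑ i ∈ I,
      (degreeLaw (k - 1) (degN T i) (2 * (k - 1) - degN T i)).real (Set.Ici t) /
        tailRate (k - 1) (maxDeg T) t -
      I.card * ((seedLaw (k - 1)).real (Set.Ici (2 * t)) / tailRate (k - 1) (maxDeg T) t)) atTop
      (nhds (I.card * cconst k (maxDeg T))) := by
    have h := (tendsto_finsetSum I fun i hi =>
      tendsto_degreeLaw_degN_div hk hT (Finset.mem_range.1 (hIk hi))).sub
      ((tendsto_seedLaw_two_mul_div (k - 1) (maxDeg T)).const_mul (I.card : ℝ))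
    rwa [Finset.sum_congr rfl fun i hi => if_pos (Finset.mem_filter.1 hi).2, Finset.sum_const,
      nsmul_eq_mul, mul_zero, sub_zero] at h
  have hup : Tendsto (fun t => ∑ i ∈ Finset.range k,
      (degreeLaw (k - 1) (degN T i) (2 * (k - 1) - degN T i)).real (Set.Ici t) /
        tailRate (k - 1) (maxDeg T) t +
      C * (tailRate (k - 1) 0 t / tailRate (k - 1) (maxDeg T) t)) atTop
      (nhds (I.card * cconst k (maxDeg T))) := by
    have h := (tendsto_finsetSum (Finset.range k) fun i hi =>
      tendsto_degreeLaw_degN_div hk hT (Finset.mem_range.1 hi)).add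
      ((tendsto_tailRate_div (k - 1) hΔ).const_mul C)
    rwa [← Finset.sum_filter, Finset.sum_const, nsmul_eq_mul, mul_zero, add_zero] at h
  refine tendsto_of_tendsto_of_tendsto_of_le_of_le' hlow hup ?_ ?_
  · filter_upwards [eventually_gt_atTop 0] with t ht
    rw [← Finset.sum_div, ← mul_div_assoc, ← sub_div]
    exact div_le_div_of_nonneg_right (le_measureReal_Dmax hk hT hX hDmax hIk t)
      (tailRate_pos _ _ ht).le
  · filter_upwards [eventually_ge_atTop 1] with t ht
    have ht0 : 0 < t := by linarith
    rw [← Finset.sum_div, ← mul_div_assoc, ← add_div]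
    refine div_le_div_of_nonneg_right ((measureReal_Dmax_le hk hT hX hDmax ht0).trans ?_)
      (tailRate_pos _ _ ht0).le
    gcongr
    exact Real.tsum_le_of_sum_range_le (fun _ => measureReal_nonneg) (hC t ht)

end seed

/-- Tail asymptotics for the limiting rescaled maximum degree: if `T` is a seed tree on
`k ≥ 2` vertices with `m` vertices of maximum degree `Δ(T)`, then
`P(D_max(T) > t) ∼ m · c(k, Δ(T)) t^(1-2k+2Δ(T)) exp(-t²/4)` as `t → ∞`, where
`D_max(T)` is the a.s. limit of `Δ(PA(n,T))/√n`. -/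
theorem tail_max_degree
    (k : ℕ) (hk : 2 ≤ k) (T : SimpleGraph ℕ) (hT : IsTreeOn k T)
    {Ω : Type} [MeasurableSpace Ω] (P : Measure Ω) [IsProbabilityMeasure P]
    (X : ℕ → Ω → SimpleGraph ℕ)
    (hX : ∀ n : ℕ, k ≤ n → P.map (X n) = PAlaw k T n)
    (Dmax : Ω → ℝ)
    (hDmax : ∀ᵐ ω ∂P,
      Filter.Tendsto (fun n : ℕ => (maxDeg (X n ω) : ℝ) / Real.sqrt n)
        Filter.atTop (nhds (Dmax ω)))
    (m : ℕ) (hm : m = ((Finset.range k).filter fun i => degN T i = maxDeg T).card) :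
    Filter.Tendsto (fun t : ℝ =>
        (P {ω | t < Dmax ω}).toReal /
          ((m : ℝ) * cconst (k : ℝ) (maxDeg T : ℝ) *
            t ^ ((1 : ℝ) - 2 * k + 2 * (maxDeg T : ℝ)) * Real.exp (-t ^ 2 / 4)))
      Filter.atTop (nhds 1) := by
  obtain ⟨v, hv, hvT⟩ := exists_lt_degN_eq_maxDeg hk hT
  have hΔ : (0 : ℝ) < maxDeg T := by exact_mod_cast hvT ▸ IsTreeOn.degN_pos hk hT hv
  have hm0 : (0 : ℝ) < m := by
    rw [hm]
    exact_mod_cast Finset.card_pos.2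
      ⟨v, Finset.mem_filter.2 ⟨Finset.mem_range.2 hv, hvT⟩⟩
  have hc : 0 < cconst k (maxDeg T) := cconst_pos (by exact_mod_cast hk) hΔ
  have h := (tendsto_measureReal_Dmax_div hk hT hX hDmax).div_const (m * cconst k (maxDeg T))
  rw [← hm, div_self (by positivity)] at h
  refine h.congr' ?_
  filter_upwards [eventually_gt_atTop 0] with t ht
  rw [mul_assoc _ (t ^ _), rpow_mul_exp_eq_tailRate (by omega) _ ht, div_div,
    mul_comm (tailRate _ _ _), measureReal_def]


end
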